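/- arXiv:2510.15008 — 2 statements merged into one kernel-verified Lean document; each statement's English description precedes it below -/
import Mathlib

section
/- ∫_0^{π/2} x ln^2(sin(x)) ln(cos(x)) dx = −(155/128)ζ(5) − (1/32)ζ(2)ζ(3) + Li_5(1/2) + (49/32) ln(2) ζ(4) − (2/3) ln^3(2) ζ(2) − (1/120) ln^5(2). -/
open Real

/-- Riemann zeta value at a positive integer `m > 1`, as the series `∑ 1/n^m`. -/
noncomputable def zetaVal (m : ℕ) : ℝ := ∑' n : ℕ, 1 / (n + 1 : ℝ) ^ m

/-- Polylogarithm `Li_m(z) = ∑_{k≥1} z^k / k^m`. -/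
noncomputable def polyLog (m : ℕ) (z : ℝ) : ℝ := ∑' k : ℕ, z ^ (k + 1) / (k + 1 : ℝ) ^ m

/-- Generalized harmonic number `H_k^{(m)} = ∑_{n=1}^k 1/n^m`. -/
noncomputable def genHarmonic (k m : ℕ) : ℝ := ∑ n ∈ Finset.range k, 1 / (n + 1 : ℝ) ^ m

section Helpers

open Set MeasureTheory Filter Topology

lemma pow_le_exp_half {s : ℝ} (hs : 0 ≤ s) (k : ℕ) :
    s ^ k ≤ (k.factorial * 2 ^ k : ℝ) * Real.exp (s / 2) := by
  have h := Real.pow_div_factorial_le_exp (s / 2) (by positivity) k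
  rw [div_pow, div_div, div_le_iff₀ (by positivity)] at h
  linarith

lemma abslog_pow_le {t : ℝ} (h0 : 0 < t) (h1 : t ≤ 1) (k : ℕ) :
    |Real.log t| ^ k ≤ (k.factorial * 2 ^ k : ℝ) * t ^ (-(1 / 2) : ℝ) := by
  have h := pow_le_exp_half (abs_nonneg (Real.log t)) k
  rw [abs_of_nonpos (Real.log_nonpos h0.le h1)] at h ⊢
  rw [Real.rpow_def_of_pos h0]
  convert h using 3
  ring

lemma one_add_abslog_pow_le {t : ℝ} (h0 : 0 < t) (h1 : t ≤ 1) (k : ℕ) :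
    (1 + |Real.log t|) ^ k ≤ (k.factorial * 2 ^ k * Real.exp (1 / 2) : ℝ) * t ^ (-(1 / 2) : ℝ) := by
  have h := pow_le_exp_half (by positivity : (0:ℝ) ≤ 1 + |Real.log t|) k
  rw [abs_of_nonpos (Real.log_nonpos h0.le h1)] at h ⊢
  rw [Real.rpow_def_of_pos h0, mul_assoc, ← Real.exp_add]
  convert h using 3
  ring

/-- dominating function -/
noncomputable def domD (t : ℝ) : ℝ := t ^ (-(1 / 2) : ℝ) + (1 - t) ^ (-(1 / 2) : ℝ)

lemma integrableOn_domD : IntegrableOn domD (Ioo 0 1) := by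
  have h1 : IntervalIntegrable (fun t : ℝ => t ^ (-(1 / 2) : ℝ)) volume 0 1 :=
    intervalIntegral.intervalIntegrable_rpow' (by norm_num)
  have h2 : IntervalIntegrable (fun t : ℝ => (1 - t) ^ (-(1 / 2) : ℝ)) volume 0 1 := by
    have := (h1.comp_sub_left 1).symm
    simpa using this
  have h3 := h1.add h2
  rw [intervalIntegrable_iff_integrableOn_Ioo_of_le (by norm_num)] at h3
  exact h3

lemma log_one_sub_abs_div_le {t : ℝ} (h0 : 0 < t) (h1 : t < 1) :
    |Real.log (1 - t)| / t ≤ 1 + |Real.log (1 - t)| := by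
  have hl : Real.log (1 - t) ≤ 0 := Real.log_nonpos (by linarith) (by linarith)
  have h := Real.one_sub_inv_le_log_of_pos (by linarith : 0 < 1 - t)
  rw [abs_of_nonpos hl, div_le_iff₀ h0]
  have h2 : (1 - (1 - t)⁻¹) * (1 - t) ≤ Real.log (1 - t) * (1 - t) :=
    mul_le_mul_of_nonneg_right h (by linarith)
  rw [sub_mul, inv_mul_cancel₀ (by linarith)] at h2
  linarith

/-- integrand -/
noncomputable def mm (a b c : ℕ) (t : ℝ) : ℝ :=
  Real.log t ^ a * Real.log (1 - t) ^ b * Real.log (1 + t) ^ c / t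

noncomputable def M (a b c : ℕ) : ℝ := ∫ t in Ioo (0:ℝ) 1, mm a b c t

lemma mm_bound (a b c : ℕ) (h : 1 ≤ b + c) : ∃ C : ℝ, 0 ≤ C ∧ ∀ t ∈ Ioo (0:ℝ) 1,
    |mm a b c t| ≤ C * domD t := by
  refine ⟨((2*a).factorial * 2 ^ (2*a) : ℝ) + ((2*b).factorial * 2 ^ (2*b) * Real.exp (1 / 2) : ℝ),
    by positivity, ?_⟩
  rintro t ⟨h0, h1⟩
  have hq0 : 0 ≤ Real.log (1 + t) := Real.log_nonneg (by linarith)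
  have hqt : Real.log (1 + t) ≤ t := by
    have := Real.log_le_sub_one_of_pos (by linarith : 0 < 1 + t); linarith
  set p := |Real.log (1 - t)| with hp
  have hp0 : 0 ≤ p := abs_nonneg _
  have hpt : p / t ≤ 1 + p := log_one_sub_abs_div_le h0 h1
  have key : p ^ b * Real.log (1 + t) ^ c / t ≤ (1 + p) ^ b := by
    rcases Nat.eq_zero_or_pos b with hb | hb
    · subst hb
      obtain ⟨c', rfl⟩ : ∃ c', c = c' + 1 := ⟨c - 1, by omega⟩
      simp only [pow_zero, one_mul]
      rw [div_le_one h0, pow_succ]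
      calc Real.log (1 + t) ^ c' * Real.log (1 + t) ≤ 1 * t :=
            mul_le_mul (pow_le_one₀ hq0 (by linarith)) hqt hq0 zero_le_one
        _ = t := one_mul t
    · obtain ⟨b', rfl⟩ : ∃ b', b = b' + 1 := ⟨b - 1, by omega⟩
      calc p ^ (b'+1) * Real.log (1 + t) ^ c / t
          = p ^ b' * (p / t) * Real.log (1 + t) ^ c := by rw [pow_succ]; ring
        _ ≤ (1 + p) ^ b' * (1 + p) * 1 := by
            gcongr
            · linarith
            · exact pow_le_one₀ hq0 (by linarith)
        _ = _ := by ring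
  have habs : |mm a b c t| = |Real.log t| ^ a * (p ^ b * Real.log (1 + t) ^ c / t) := by
    unfold mm
    rw [abs_div, abs_mul, abs_mul, abs_pow, abs_pow, abs_pow, abs_of_nonneg hq0, abs_of_pos h0]
    ring
  rw [habs]
  have A := abslog_pow_le h0 h1.le (2*a)
  have B := one_add_abslog_pow_le (by linarith : 0 < 1 - t) (by linarith) (2*b)
  rw [← hp] at B
  have r1 : 0 ≤ t ^ (-(1 / 2) : ℝ) := by positivity
  have r2 : 0 ≤ (1 - t) ^ (-(1 / 2) : ℝ) := Real.rpow_nonneg (by linarith) _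
  set X := |Real.log t| ^ a with hX
  have e1 : |Real.log t| ^ (2*a) = X ^ 2 := by rw [hX]; ring
  have e2 : (1 + p) ^ (2*b) = ((1+p)^b) ^ 2 := by ring
  have hX0 : 0 ≤ X := by positivity
  calc X * (p ^ b * Real.log (1 + t) ^ c / t) ≤ X * (1 + p) ^ b := by gcongr
    _ ≤ X ^ 2 + ((1+p)^b) ^ 2 := by nlinarith [sq_nonneg (X - (1+p)^b), sq_nonneg (X + (1+p)^b)]
    _ ≤ _ := by
      rw [← e1, ← e2]
      unfold domD
      have k1 : (0:ℝ) ≤ ((2*a).factorial * 2 ^ (2*a) : ℝ) := by positivity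
      have k2 : (0:ℝ) ≤ ((2*b).factorial * 2 ^ (2*b) * Real.exp (1 / 2) : ℝ) := by positivity
      nlinarith [mul_nonneg k1 r2, mul_nonneg k2 r1]

lemma mm_measurable (a b c : ℕ) : Measurable (mm a b c) := by
  unfold mm; fun_prop

lemma mm_int (a b c : ℕ) (h : 1 ≤ b + c) : IntegrableOn (mm a b c) (Ioo 0 1) := by
  obtain ⟨C, -, hC⟩ := mm_bound a b c h
  refine Integrable.mono' (integrableOn_domD.const_mul C) (mm_measurable a b c).aestronglyMeasurable ?_
  filter_upwards [ae_restrict_mem measurableSet_Ioo] with t ht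
  exact hC t ht

/-- half-interval integrals -/
noncomputable def EE (a b : ℕ) : ℝ :=
  ∫ y in Ioo (0:ℝ) (1/2), Real.log y ^ a * Real.log (1 - y) ^ b / y

noncomputable def GG (a b : ℕ) : ℝ :=
  ∫ y in Ioo (0:ℝ) (1/2), Real.log y ^ a * Real.log (1 - y) ^ b / (1 - y)

lemma mm_zero (a b : ℕ) : mm a b 0 = fun y => Real.log y ^ a * Real.log (1 - y) ^ b / y := by
  ext y; simp [mm]

lemma EE_int (a b : ℕ) (h : 1 ≤ b) :
    IntegrableOn (fun y => Real.log y ^ a * Real.log (1 - y) ^ b / y) (Ioo 0 (1/2)) := by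
  rw [← mm_zero]
  exact (mm_int a b 0 (by omega)).mono_set (Ioo_subset_Ioo_right (by norm_num))

lemma GG_int (a b : ℕ) (h : 1 ≤ b) :
    IntegrableOn (fun y => Real.log y ^ a * Real.log (1 - y) ^ b / (1 - y)) (Ioo 0 (1/2)) := by
  refine Integrable.mono (EE_int a b h) (Measurable.aestronglyMeasurable (by fun_prop)) ?_
  filter_upwards [ae_restrict_mem measurableSet_Ioo] with t ht
  obtain ⟨h0, h1⟩ := ht
  rw [norm_div, norm_div]
  refine div_le_div_of_nonneg_left (norm_nonneg _) (by simpa using h0.ne') ?_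
  rw [Real.norm_of_nonneg h0.le, Real.norm_of_nonneg (by linarith)]
  linarith

/-- reflection -/
lemma M_refl (a b : ℕ) (ha : 1 ≤ a) (hb : 1 ≤ b) : M a b 0 = EE a b + GG b a := by
  have hu : Ioo (0:ℝ) 1 = Ioo 0 (1/2) ∪ Ico (1/2) 1 := by
    rw [Ioo_union_Ico_eq_Ioo] <;> norm_num
  have hI := mm_int a b 0 (by omega)
  unfold M
  rw [hu, setIntegral_union _ measurableSet_Ico
    (hI.mono_set (Ioo_subset_Ioo_right (by norm_num))) (hI.mono_set _), integral_Ico_eq_integral_Ioo]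
  · congr 1
    · simp [mm, EE]
    · unfold GG
      have himg : (fun y : ℝ => 1 - y) '' Ioo (0:ℝ) (1/2) = Ioo (1/2) 1 := by
        rw [Set.image_const_sub_Ioo]; norm_num
      rw [← himg, integral_image_eq_integral_abs_deriv_smul (f' := fun _ => -1) measurableSet_Ioo]
      · refine integral_congr_ae (ae_of_all _ fun y => ?_)
        simp [mm]; ring
      · intro x _
        simpa using ((hasDerivAt_id x).const_sub 1).hasDerivWithinAt
      · intro x _ y _ hxy
        simpa using hxy
  · rw [Set.disjoint_left]; rintro x hx hx'; linarith [hx.2, hx'.1]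
  · intro x hx; exact ⟨by linarith [hx.1], hx.2⟩

/-- IBP boundary at zero -/
lemma tendsto_log_pow_mul (a b : ℕ) :
    Tendsto (fun y : ℝ => Real.log y ^ a * Real.log (1 - y) ^ (b+1)) (𝓝[>] 0) (𝓝 0) := by
  have h1 : Tendsto (fun y : ℝ => Real.log y ^ a * y) (𝓝[>] 0) (𝓝 0) := by
    have hb : ∀ᶠ y in 𝓝[>] (0:ℝ), |Real.log y ^ a * y| ≤ (a.factorial * 2 ^ a : ℝ) * y ^ (1/2 : ℝ) := by
      filter_upwards [Ioo_mem_nhdsGT (zero_lt_one)] with y hy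
      have := abslog_pow_le hy.1 hy.2.le a
      rw [abs_mul, abs_pow, abs_of_pos hy.1]
      calc |Real.log y| ^ a * y ≤ (a.factorial * 2 ^ a : ℝ) * y ^ (-(1 / 2) : ℝ) * y := by
            gcongr; exact hy.1.le
        _ = (a.factorial * 2 ^ a : ℝ) * (y ^ (-(1 / 2) : ℝ) * y ^ (1:ℝ)) := by rw [Real.rpow_one]; ring
        _ = _ := by rw [← Real.rpow_add hy.1]; norm_num
    refine squeeze_zero_norm' hb ?_
    have hc : Continuous fun y : ℝ => (a.factorial * 2 ^ a : ℝ) * y ^ (1/2 : ℝ) :=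
      continuous_const.mul (Real.continuous_rpow_const (by norm_num))
    have := hc.tendsto 0
    simp only [Real.zero_rpow (by norm_num : (1/2:ℝ) ≠ 0), mul_zero] at this
    exact this.mono_left nhdsWithin_le_nhds
  have hb : ∀ᶠ y in 𝓝[>] (0:ℝ), |Real.log y ^ a * Real.log (1 - y) ^ (b+1)| ≤
      2 ^ (b+1) * |Real.log y ^ a * y| := by
    filter_upwards [Ioo_mem_nhdsGT (by norm_num : (0:ℝ) < 1/2)] with y hy
    have h2 : |Real.log (1 - y)| ≤ 2 * y := by
      have h := Real.one_sub_inv_le_log_of_pos (by linarith [hy.2] : 0 < 1 - y)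
      rw [abs_of_nonpos (Real.log_nonpos (by linarith [hy.2]) (by linarith [hy.1]))]
      have : (1 - y)⁻¹ ≤ 1 + 2 * y := by
        rw [inv_le_iff_one_le_mul₀ (by linarith [hy.2])]
        nlinarith [hy.1, hy.2]
      linarith
    rw [abs_mul, abs_mul, abs_pow (Real.log (1 - y)), abs_of_pos hy.1]
    calc |Real.log y ^ a| * |Real.log (1 - y)| ^ (b+1) ≤ |Real.log y ^ a| * (2 * y) ^ (b+1) := by gcongr
      _ = 2 ^ (b+1) * (|Real.log y ^ a| * (y ^ b * y)) := by ring
      _ ≤ 2 ^ (b+1) * (|Real.log y ^ a| * (1 * y)) := by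
          gcongr
          · exact hy.1.le
          · exact pow_le_one₀ hy.1.le (by linarith [hy.2])
      _ = _ := by ring
  refine squeeze_zero_norm' hb ?_
  simpa using (h1.abs).const_mul (2 ^ (b+1) : ℝ)

lemma log_half : Real.log (1/2) = - Real.log 2 := by
  rw [one_div, Real.log_inv]

lemma IBP (a b : ℕ) (hb : 1 ≤ b) :
    (a:ℝ) * EE (a-1) (b+1) - (b+1) * GG a b = (-Real.log 2) ^ (a + b + 1) := by
  have hInt0 : IntegrableOn (fun y : ℝ => a * (Real.log y ^ (a-1) * Real.log (1 - y) ^ (b+1) / y)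
      - (b+1) * (Real.log y ^ a * Real.log (1 - y) ^ b / (1 - y))) (Ioo 0 (1/2)) :=
    ((EE_int (a-1) (b+1) (by omega)).const_mul _).sub ((GG_int a b hb).const_mul _)
  have key := intervalIntegral.integral_eq_sub_of_hasDerivAt_of_tendsto
    (f := fun y : ℝ => Real.log y ^ a * Real.log (1 - y) ^ (b+1))
    (f' := fun y : ℝ => a * (Real.log y ^ (a-1) * Real.log (1 - y) ^ (b+1) / y)
      - (b+1) * (Real.log y ^ a * Real.log (1 - y) ^ b / (1 - y)))
    (a := 0) (b := 1/2) (fa := 0) (fb := (-Real.log 2) ^ (a + b + 1)) (by norm_num) ?_ ?_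
    (tendsto_log_pow_mul a b) ?_
  · rw [intervalIntegral.integral_of_le (by norm_num), integral_Ioc_eq_integral_Ioo,
      integral_sub, integral_const_mul, integral_const_mul] at key
    · rw [EE, GG, key]; ring
    · exact (EE_int (a-1) (b+1) (by omega)).const_mul _
    · exact (GG_int a b hb).const_mul _
  · intro y hy
    have h1 := (Real.hasDerivAt_log hy.1.ne').pow a
    have h2 : HasDerivAt (fun y : ℝ => Real.log (1 - y)) (-1 / (1 - y)) y :=
      ((hasDerivAt_id y).const_sub 1).log (by simp only [id]; linarith [hy.2])
    have h3 := h1.mul (h2.pow (b+1))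
    have hy0 : y ≠ 0 := hy.1.ne'
    have hy1 : 1 - y ≠ 0 := by linarith [hy.2]
    convert! h3 using 1
    simp only [Pi.pow_apply, Nat.add_sub_cancel]
    push_cast
    field_simp
    ring
  · rw [intervalIntegrable_iff_integrableOn_Ioo_of_le (by norm_num)]
    exact hInt0
  · have hc : ContinuousAt (fun y : ℝ => Real.log y ^ a * Real.log (1 - y) ^ (b+1)) (1/2) := by
      refine ((Real.continuousAt_log (by norm_num)).pow a).mul (ContinuousAt.pow ?_ _)
      exact ContinuousAt.log (by fun_prop) (by norm_num)
    have := hc.tendsto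
    rw [show (1:ℝ) - 1/2 = 1/2 by norm_num, log_half] at this
    have e : (-Real.log 2) ^ (a + b + 1) = (-Real.log 2) ^ a * (-Real.log 2) ^ (b+1) := by ring
    rw [e]
    exact this.mono_left nhdsWithin_le_nhds

noncomputable def ww (a b c : ℕ) (y : ℝ) : ℝ :=
  (Real.log y - Real.log (1 - y)) ^ a * (Real.log y ^ c * Real.log (1 - y) ^ b / y
    + Real.log y ^ c * Real.log (1 - y) ^ b / (1 - y))

noncomputable def WW (a b c : ℕ) : ℝ := ∫ y in Ioo (0:ℝ) (1/2), ww a b c y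

lemma ww_succ (a b c : ℕ) : ww (a+1) b c = fun y => ww a b (c+1) y - ww a (b+1) c y := by
  ext y; unfold ww; ring

lemma ww_int (a b c : ℕ) (hb : 1 ≤ b) : IntegrableOn (ww a b c) (Ioo 0 (1/2)) := by
  induction a generalizing b c with
  | zero =>
    have : ww 0 b c = fun y => Real.log y ^ c * Real.log (1 - y) ^ b / y
      + Real.log y ^ c * Real.log (1 - y) ^ b / (1 - y) := by ext y; simp [ww]
    rw [this]
    exact (EE_int c b hb).add (GG_int c b hb)
  | succ a ih =>
    rw [ww_succ]
    exact (ih b (c+1) hb).sub (ih (b+1) c (by omega))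

lemma WW_zero (b c : ℕ) (hb : 1 ≤ b) : WW 0 b c = EE c b + GG c b := by
  unfold WW EE GG
  rw [← integral_add (EE_int c b hb) (GG_int c b hb)]
  simp [ww]

lemma WW_succ (a b c : ℕ) (hb : 1 ≤ b) : WW (a+1) b c = WW a b (c+1) - WW a (b+1) c := by
  unfold WW
  rw [ww_succ, integral_sub (ww_int a b (c+1) hb) (ww_int a (b+1) c (by omega))]

lemma M_sub (a b : ℕ) : M a 0 b = (-1) ^ b * WW a b 0 := by
  unfold M WW
  have himg : (fun y : ℝ => y / (1 - y)) '' Ioo (0:ℝ) (1/2) = Ioo 0 1 := by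
    ext s
    constructor
    · rintro ⟨y, ⟨h0, h1⟩, rfl⟩
      have : 0 < 1 - y := by linarith
      refine ⟨by positivity, ?_⟩
      show y / (1 - y) < 1
      rw [div_lt_one this]; linarith
    · rintro ⟨h0, h1⟩
      have hs : 0 < 1 + s := by linarith
      refine ⟨s / (1 + s), ⟨by positivity, ?_⟩, ?_⟩
      · rw [div_lt_div_iff₀ hs (by norm_num)]; linarith
      · field_simp; ring
  rw [← himg, integral_image_eq_integral_abs_deriv_smul (f' := fun y => 1 / (1 - y)^2)
    measurableSet_Ioo, ← integral_const_mul]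
  · refine setIntegral_congr_fun measurableSet_Ioo ?_
    rintro y ⟨h0, h1⟩
    have h2 : 0 < 1 - y := by linarith
    have e1 : Real.log (y / (1 - y)) = Real.log y - Real.log (1 - y) :=
      Real.log_div h0.ne' h2.ne'
    have e2 : Real.log (1 + y / (1 - y)) = - Real.log (1 - y) := by
      rw [← Real.log_inv]; congr 1; field_simp; ring
    simp only [mm, ww, e1, e2, smul_eq_mul]
    rw [abs_of_pos (by positivity)]
    rw [neg_pow (Real.log (1 - y))]
    field_simp
    ring
  · rintro y ⟨h0, h1⟩
    have h2 : 1 - y ≠ 0 := by linarith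
    have := (hasDerivAt_id y).div ((hasDerivAt_id y).const_sub 1) h2
    refine (HasDerivAt.hasDerivWithinAt ?_)
    convert! this using 1
    simp
  · rintro x ⟨hx0, hx1⟩ y ⟨hy0, hy1⟩ hxy
    have h2 : 1 - y ≠ 0 := by linarith
    have h3 : 1 - x ≠ 0 := by linarith
    simp only at hxy
    field_simp at hxy
    linarith

lemma M_sq (a b : ℕ) : M a b 0 = 2 ^ (a+1) * ∫ t in Ioo (0:ℝ) 1,
    Real.log t ^ a * (Real.log (1 - t) + Real.log (1 + t)) ^ b / t := by
  unfold M
  have himg : (fun y : ℝ => y ^ 2) '' Ioo (0:ℝ) 1 = Ioo 0 1 := by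
    ext s
    constructor
    · rintro ⟨y, ⟨h0, h1⟩, rfl⟩
      exact ⟨by positivity, by simpa using pow_lt_one₀ h0.le h1 two_ne_zero⟩
    · rintro ⟨h0, h1⟩
      exact ⟨√s, ⟨Real.sqrt_pos.2 h0, by rw [Real.sqrt_lt' one_pos]; simpa using h1⟩,
        Real.sq_sqrt h0.le⟩
  conv_lhs => rw [← himg]
  rw [integral_image_eq_integral_abs_deriv_smul (f' := fun y => 2 * y)
    measurableSet_Ioo, ← integral_const_mul]
  · refine setIntegral_congr_fun measurableSet_Ioo ?_
    rintro y ⟨h0, h1⟩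
    have h2 : 0 < 1 - y := by linarith
    have h3 : 0 < 1 + y := by linarith
    have e1 : Real.log (y ^ 2) = 2 * Real.log y := by simp
    have e2 : Real.log (1 - y ^ 2) = Real.log (1 - y) + Real.log (1 + y) := by
      rw [← Real.log_mul h2.ne' h3.ne']; congr 1; ring
    simp only [mm, e1, e2, smul_eq_mul]
    rw [abs_of_pos (by positivity)]
    field_simp
    ring
  · rintro y ⟨h0, h1⟩
    simpa using (hasDerivAt_pow 2 y).hasDerivWithinAt
  · rintro x ⟨hx0, hx1⟩ y ⟨hy0, hy1⟩ hxy
    simp only at hxy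
    nlinarith

lemma M_sq_one (a : ℕ) : M a 1 0 = 2 ^ (a+1) * (M a 1 0 + M a 0 1) := by
  conv_lhs => rw [M_sq]
  unfold M
  rw [← integral_add (mm_int a 1 0 (by omega)) (mm_int a 0 1 (by omega))]
  congr 2
  ext t; simp only [mm]; ring

lemma M_sq_two (a : ℕ) : M a 2 0 = 2 ^ (a+1) * (M a 2 0 + 2 * M a 1 1 + M a 0 2) := by
  conv_lhs => rw [M_sq]
  unfold M
  rw [← integral_const_mul (2:ℝ) (mm a 1 1), ← integral_add (mm_int a 2 0 (by omega)) ((mm_int a 1 1 (by omega)).const_mul 2),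
    ← integral_add _ (mm_int a 0 2 (by omega))]
  · congr 2
    ext t; simp only [mm]; ring
  · exact (mm_int a 2 0 (by omega)).add ((mm_int a 1 1 (by omega)).const_mul 2)

/-- Moebius integrand -/
lemma q_le_p {t : ℝ} (h0 : 0 < t) (h1 : t < 1) :
    |Real.log (1 - t) - Real.log (1 + t)| ≤ 2 * |Real.log (1 - t)| := by
  have hl : Real.log (1 - t) ≤ 0 := Real.log_nonpos (by linarith) (by linarith)
  have hq : 0 ≤ Real.log (1 + t) := Real.log_nonneg (by linarith)
  have : Real.log (1 - t) + Real.log (1 + t) ≤ 0 := by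
    rw [← Real.log_mul (by linarith) (by linarith)]
    exact Real.log_nonpos (by nlinarith) (by nlinarith)
  rw [abs_of_nonpos (by linarith), abs_of_nonpos hl]
  linarith

lemma M_moebius : M 1 3 0 - 3 * M 1 2 1 + 3 * M 1 1 2 - M 1 0 3
    = 3/2 * (M 2 2 0 - 2 * M 2 1 1 + M 2 0 2) := by
  set v : ℝ → ℝ := fun t => Real.log (1 - t) - Real.log (1 + t) with hv
  have i1 : IntegrableOn (fun t => Real.log t * v t ^ 3 / t) (Ioo 0 1) := by
    have := (((mm_int 1 3 0 (by omega)).sub ((mm_int 1 2 1 (by omega)).const_mul 3)).add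
      ((mm_int 1 1 2 (by omega)).const_mul 3)).sub (mm_int 1 0 3 (by omega))
    refine this.congr (ae_of_all _ fun t => ?_)
    simp only [mm, hv, Pi.sub_apply, Pi.add_apply]; ring
  have l1 : M 1 3 0 - 3 * M 1 2 1 + 3 * M 1 1 2 - M 1 0 3
      = ∫ t in Ioo (0:ℝ) 1, Real.log t * v t ^ 3 / t := by
    unfold M
    rw [← integral_const_mul, ← integral_const_mul, ← integral_sub, ← integral_add, ← integral_sub]
    · congr 1
      ext t; simp only [mm, hv]; ring
    · exact (((mm_int 1 3 0 (by omega)).sub ((mm_int 1 2 1 (by omega)).const_mul 3)).add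
        ((mm_int 1 1 2 (by omega)).const_mul 3))
    · exact mm_int 1 0 3 (by omega)
    · exact ((mm_int 1 3 0 (by omega)).sub ((mm_int 1 2 1 (by omega)).const_mul 3))
    · exact ((mm_int 1 1 2 (by omega)).const_mul 3)
    · exact mm_int 1 3 0 (by omega)
    · exact ((mm_int 1 2 1 (by omega)).const_mul 3)
  have i2 : IntegrableOn (fun t => Real.log t ^ 2 * v t ^ 2 / t) (Ioo 0 1) := by
    have := (((mm_int 2 2 0 (by omega)).sub ((mm_int 2 1 1 (by omega)).const_mul 2)).add
      (mm_int 2 0 2 (by omega)))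
    refine this.congr (ae_of_all _ fun t => ?_)
    simp only [mm, hv, Pi.sub_apply, Pi.add_apply]; ring
  have l2 : M 2 2 0 - 2 * M 2 1 1 + M 2 0 2
      = ∫ t in Ioo (0:ℝ) 1, Real.log t ^ 2 * v t ^ 2 / t := by
    unfold M
    rw [← integral_const_mul, ← integral_sub, ← integral_add]
    · congr 1
      ext t; simp only [mm, hv]; ring
    · exact ((mm_int 2 2 0 (by omega)).sub ((mm_int 2 1 1 (by omega)).const_mul 2))
    · exact mm_int 2 0 2 (by omega)
    · exact mm_int 2 2 0 (by omega)
    · exact ((mm_int 2 1 1 (by omega)).const_mul 2)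
  rw [l1, l2]
  -- change of variables
  have himg : (fun y : ℝ => (1 - y) / (1 + y)) '' Ioo (0:ℝ) 1 = Ioo 0 1 := by
    ext s
    constructor
    · rintro ⟨y, ⟨h0, h1⟩, rfl⟩
      have h2 : 0 < 1 - y := by linarith
      have h3 : 0 < 1 + y := by linarith
      refine ⟨by positivity, ?_⟩
      show (1 - y) / (1 + y) < 1
      rw [div_lt_one h3]; linarith
    · rintro ⟨h0, h1⟩
      have h2 : 0 < 1 - s := by linarith
      have h3 : 0 < 1 + s := by linarith
      refine ⟨(1 - s) / (1 + s), ⟨by positivity, ?_⟩, ?_⟩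
      · rw [div_lt_one h3]; linarith
      · field_simp; ring
  have hder : ∀ y ∈ Ioo (0:ℝ) 1, HasDerivWithinAt (fun y : ℝ => (1 - y) / (1 + y))
      ((fun y => -2 / (1 + y)^2) y) (Ioo 0 1) y := by
    rintro y ⟨h0, h1⟩
    have h2 : 1 + y ≠ 0 := by linarith
    have := ((hasDerivAt_id y).const_sub 1).div ((hasDerivAt_id y).const_add 1) h2
    refine (HasDerivAt.hasDerivWithinAt ?_)
    convert! this using 1
    simp; ring
  have hinj : InjOn (fun y : ℝ => (1 - y) / (1 + y)) (Ioo 0 1) := by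
    rintro x ⟨hx0, hx1⟩ y ⟨hy0, hy1⟩ hxy
    have h2 : 1 + y ≠ 0 := by linarith
    have h3 : 1 + x ≠ 0 := by linarith
    simp only at hxy
    field_simp at hxy
    linarith
  have hpt : ∀ u ∈ Ioo (0:ℝ) 1, |(fun y : ℝ => -2 / (1 + y)^2) u| •
      ((fun t => Real.log t * v t ^ 3 / t) ((1 - u) / (1 + u)))
      = 2 / (1 - u^2) * (v u * Real.log u ^ 3) := by
    rintro u ⟨h0, h1⟩
    have h2 : 0 < 1 - u := by linarith
    have h3 : 0 < 1 + u := by linarith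
    have e1 : Real.log ((1 - u) / (1 + u)) = v u := Real.log_div h2.ne' h3.ne'
    have e2 : v ((1 - u) / (1 + u)) = Real.log u := by
      have a1 : 1 - (1 - u) / (1 + u) = 2 * u / (1 + u) := by field_simp; ring
      have a2 : 1 + (1 - u) / (1 + u) = 2 / (1 + u) := by field_simp; ring
      simp only [hv]
      rw [a1, a2, ← Real.log_div (by positivity) (by positivity)]
      congr 1; field_simp
    simp only [smul_eq_mul]
    rw [e1, e2, neg_div, abs_neg, abs_of_pos (by positivity)]
    have h4 : 1 - u^2 = (1 - u) * (1 + u) := by ring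
    rw [h4]
    field_simp
  have i3 : IntegrableOn (fun u => 2 / (1 - u^2) * (v u * Real.log u ^ 3)) (Ioo 0 1) := by
    have h := i1
    rw [← himg, integrableOn_image_iff_integrableOn_abs_deriv_smul measurableSet_Ioo hder hinj] at h
    exact h.congr_fun hpt measurableSet_Ioo
  have l3 : ∫ t in Ioo (0:ℝ) 1, Real.log t * v t ^ 3 / t
      = ∫ u in Ioo (0:ℝ) 1, 2 / (1 - u^2) * (v u * Real.log u ^ 3) := by
    conv_lhs => rw [← himg]
    rw [integral_image_eq_integral_abs_deriv_smul measurableSet_Ioo hder hinj]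
    exact setIntegral_congr_fun measurableSet_Ioo hpt
  rw [l3]
  have key := intervalIntegral.integral_eq_sub_of_hasDerivAt_of_tendsto
    (f := fun u : ℝ => v u ^ 2 * Real.log u ^ 3)
    (f' := fun u : ℝ => 3 * (Real.log u ^ 2 * v u ^ 2 / u)
      - 2 * (2 / (1 - u^2) * (v u * Real.log u ^ 3)))
    (a := 0) (b := 1) (fa := 0) (fb := 0) (by norm_num) ?_ ?_ ?_ ?_
  · rw [intervalIntegral.integral_of_le (by norm_num), integral_Ioc_eq_integral_Ioo,
      integral_sub, integral_const_mul, integral_const_mul] at key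
    · linarith
    · exact i2.const_mul _
    · exact i3.const_mul _
  · rintro u ⟨h0, h1⟩
    have h2 : 1 - u ≠ 0 := by linarith
    have h3 : 1 + u ≠ 0 := by linarith
    have h4 : 1 - u^2 = (1 - u) * (1 + u) := by ring
    have d1 : HasDerivAt (fun y : ℝ => Real.log (1 - y)) (-1 / (1 - u)) u :=
      ((hasDerivAt_id u).const_sub 1).log (by simpa using h2)
    have d2 : HasDerivAt (fun y : ℝ => Real.log (1 + y)) (1 / (1 + u)) u :=
      ((hasDerivAt_id u).const_add 1).log (by simpa using h3)
    have d3 := ((d1.sub d2).pow 2).mul ((Real.hasDerivAt_log h0.ne').pow 3)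
    convert! d3 using 1
    simp only [hv, h4, Pi.pow_apply, Pi.sub_apply]
    have := h0.ne'
    field_simp
    ring
  · rw [intervalIntegrable_iff_integrableOn_Ioo_of_le (by norm_num)]
    exact (i2.const_mul _).sub (i3.const_mul _)
  · have ht := (tendsto_log_pow_mul 3 1).abs.const_mul 4
    simp only [abs_zero, mul_zero] at ht
    refine squeeze_zero_norm' ?_ ht
    filter_upwards [Ioo_mem_nhdsGT (zero_lt_one)] with y hy
    have := q_le_p hy.1 hy.2
    rw [Real.norm_eq_abs, abs_mul, abs_mul, abs_pow, abs_pow (Real.log (1 - y))]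
    calc |v y| ^ 2 * |Real.log y ^ 3| ≤ (2 * |Real.log (1 - y)|) ^ 2 * |Real.log y ^ 3| := by gcongr
      _ = _ := by ring
  · have ht := (tendsto_log_pow_mul 2 2).abs.const_mul 4
    simp only [abs_zero, mul_zero] at ht
    have hr : Tendsto (fun u : ℝ => 1 - u) (𝓝[<] 1) (𝓝[>] 0) := by
      rw [tendsto_nhdsWithin_iff]
      constructor
      · have : Continuous fun u : ℝ => 1 - u := by fun_prop
        have := this.tendsto 1
        rw [sub_self] at this
        exact this.mono_left nhdsWithin_le_nhds
      · filter_upwards [self_mem_nhdsWithin] with u hu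
        simpa using hu
    refine squeeze_zero_norm' ?_ (ht.comp hr)
    filter_upwards [Ioo_mem_nhdsLT (zero_lt_one)] with y hy
    have := q_le_p hy.1 hy.2
    simp only [Function.comp]
    rw [Real.norm_eq_abs, abs_mul, abs_mul, abs_pow, abs_pow (Real.log (1 - y)),
      show 1 - (1 - y) = y by ring]
    calc |v y| ^ 2 * |Real.log y ^ 3| ≤ (2 * |Real.log (1 - y)|) ^ 2 * |Real.log y ^ 3| := by gcongr
      _ = _ := by simp only [Nat.reduceAdd]; ring

lemma powlog_int (n k : ℕ) : IntegrableOn (fun y : ℝ => y ^ n * Real.log y ^ k) (Ioo 0 1) := by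
  refine Integrable.mono' (integrableOn_domD.const_mul (k.factorial * 2 ^ k : ℝ))
    (Measurable.aestronglyMeasurable (by fun_prop)) ?_
  filter_upwards [ae_restrict_mem measurableSet_Ioo] with t ht
  have h := abslog_pow_le ht.1 ht.2.le k
  have r2 : 0 ≤ (1 - t) ^ (-(1 / 2) : ℝ) := Real.rpow_nonneg (by linarith [ht.2]) _
  rw [norm_mul, norm_pow, norm_pow, Real.norm_of_nonneg ht.1.le, Real.norm_eq_abs]
  calc t ^ n * |Real.log t| ^ k ≤ 1 * |Real.log t| ^ k := by
        gcongr; exact pow_le_one₀ ht.1.le ht.2.le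
    _ ≤ (k.factorial * 2 ^ k : ℝ) * t ^ (-(1 / 2) : ℝ) := by linarith
    _ ≤ _ := by
      unfold domD
      gcongr
      linarith

lemma powlog_integral (n k : ℕ) : ∫ y in Ioo (0:ℝ) 1, y ^ n * Real.log y ^ k
    = (-1) ^ k * k.factorial / (n + 1) ^ (k + 1) := by
  induction k with
  | zero =>
    rw [← integral_Ioc_eq_integral_Ioo, ← intervalIntegral.integral_of_le (by norm_num)]
    simp
  | succ k ih =>
    have key := intervalIntegral.integral_eq_sub_of_hasDerivAt_of_tendsto
      (f := fun u : ℝ => u ^ (n+1) * Real.log u ^ (k+1))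
      (f' := fun u : ℝ => (n + 1) * (u ^ n * Real.log u ^ (k+1))
        + (k+1) * (u ^ n * Real.log u ^ k))
      (a := 0) (b := 1) (fa := 0) (fb := 0) (by norm_num) ?_ ?_ ?_ ?_
    · rw [intervalIntegral.integral_of_le (by norm_num), integral_Ioc_eq_integral_Ioo,
        integral_add, integral_const_mul, integral_const_mul, ih] at key
      · have hn : (n:ℝ) + 1 ≠ 0 := by positivity
        rw [Nat.factorial_succ]
        push_cast
        field_simp at key ⊢
        linear_combination key
      · exact (powlog_int n (k+1)).const_mul _
      · exact (powlog_int n k).const_mul _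
    · rintro u ⟨h0, h1⟩
      have d3 := (hasDerivAt_pow (n+1) u).mul ((Real.hasDerivAt_log h0.ne').pow (k+1))
      convert! d3 using 1
      have := h0.ne'
      simp only [Pi.pow_apply, Nat.add_sub_cancel]
      push_cast
      field_simp
      ring
    · rw [intervalIntegrable_iff_integrableOn_Ioo_of_le (by norm_num)]
      exact ((powlog_int n (k+1)).const_mul _).add ((powlog_int n k).const_mul _)
    · have ht := (tendsto_log_pow_mul (k+1) 0).abs
      simp only [abs_zero] at ht
      refine squeeze_zero_norm' ?_ ht
      filter_upwards [Ioo_mem_nhdsGT (zero_lt_one)] with y hy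
      have hl : Real.log (1 - y) ≤ -y := by
        have := Real.log_le_sub_one_of_pos (by linarith [hy.2] : 0 < 1 - y); linarith
      have h1 : y ≤ |Real.log (1 - y)| := by
        rw [abs_of_nonpos (by linarith [hy.1])]; linarith
      rw [Real.norm_eq_abs, abs_mul, abs_mul, abs_of_nonneg (pow_nonneg hy.1.le _), zero_add, pow_one,
        mul_comm]
      gcongr
      refine le_trans ?_ h1
      rw [pow_succ]
      exact mul_le_of_le_one_left hy.1.le (pow_le_one₀ hy.1.le hy.2.le)
    · have hc : ContinuousAt (fun u : ℝ => u ^ (n+1) * Real.log u ^ (k+1)) 1 := by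
        refine ContinuousAt.mul (by fun_prop) ((Real.continuousAt_log (by norm_num)).pow _)
      have := hc.tendsto
      simp only [Real.log_one, one_pow, ne_eq, Nat.add_eq_zero_iff, one_ne_zero, and_false,
        not_false_eq_true, zero_pow, mul_zero] at this
      exact this.mono_left nhdsWithin_le_nhds

lemma powlog_norm_integral (n k : ℕ) : ∫ y in Ioo (0:ℝ) 1, ‖y ^ n * Real.log y ^ k‖
    = k.factorial / (n + 1) ^ (k + 1) := by
  have : ∫ y in Ioo (0:ℝ) 1, ‖y ^ n * Real.log y ^ k‖
      = ∫ y in Ioo (0:ℝ) 1, (-1) ^ k * (y ^ n * Real.log y ^ k) := by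
    refine setIntegral_congr_fun measurableSet_Ioo ?_
    rintro y ⟨h0, h1⟩
    simp only [norm_mul, norm_pow]
    rw [Real.norm_of_nonneg h0.le, Real.norm_of_nonpos (Real.log_nonpos h0.le h1.le), neg_pow]
    ring
  rw [this, integral_const_mul, powlog_integral, ← mul_div_assoc, ← mul_assoc, ← mul_pow]
  simp

lemma summable_inv_pow (m : ℕ) (hm : 2 ≤ m) : Summable fun n : ℕ => 1 / ((n:ℝ) + 1) ^ m := by
  have := (summable_nat_add_iff 1).2 (Real.summable_one_div_nat_pow.2 (by omega : 1 < m))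
  simpa using this

lemma polyLog_integral (k : ℕ) (c : ℝ) (hc : |c| ≤ 1) :
    ∫ z in Ioo (0:ℝ) 1, Real.log z ^ k * Real.log (1 - c * z) / z
    = (-1) ^ (k+1) * k.factorial * polyLog (k+2) c := by
  have hI : ∀ n : ℕ, ∫ z in Ioo (0:ℝ) 1, -(c ^ (n+1) / (n+1)) * (z ^ n * Real.log z ^ k)
      = (-1) ^ (k+1) * k.factorial * (c ^ (n+1) / (n+1) ^ (k+2)) := by
    intro n
    rw [integral_const_mul, powlog_integral]
    have hn : (n:ℝ) + 1 ≠ 0 := by positivity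
    field_simp
    ring
  have hN : ∀ n : ℕ, ∫ z in Ioo (0:ℝ) 1, ‖-(c ^ (n+1) / (n+1)) * (z ^ n * Real.log z ^ k)‖
      = k.factorial * (|c| ^ (n+1) / (n+1) ^ (k+2)) := by
    intro n
    have hn : (0:ℝ) < (n:ℝ) + 1 := by positivity
    simp_rw [norm_mul (-(c ^ (n+1) / (n+1)))]
    rw [integral_const_mul, powlog_norm_integral]
    rw [norm_neg, norm_div, norm_pow, Real.norm_of_nonneg hn.le, Real.norm_eq_abs]
    field_simp
    ring
  have hS : Summable fun n : ℕ => ∫ z in Ioo (0:ℝ) 1, ‖-(c ^ (n+1) / (n+1)) * (z ^ n * Real.log z ^ k)‖ := by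
    simp_rw [hN]
    refine Summable.mul_left _ ?_
    refine Summable.of_nonneg_of_le (fun n => by positivity) (fun n => ?_) (summable_inv_pow (k+2) (by omega))
    gcongr
    exact pow_le_one₀ (abs_nonneg _) hc
  have := hasSum_integral_of_summable_integral_norm
    (fun n : ℕ => ((powlog_int n k).const_mul (-(c ^ (n+1) / ((n:ℝ)+1))))) hS
  simp_rw [hI] at this
  unfold polyLog
  rw [← tsum_mul_left, this.tsum_eq]
  refine setIntegral_congr_fun measurableSet_Ioo ?_
  rintro z ⟨h0, h1⟩
  have hcz : |c * z| < 1 := by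
    rw [abs_mul, abs_of_pos h0]; nlinarith [abs_nonneg c]
  have hs := (Real.hasSum_pow_div_log_of_abs_lt_one hcz).mul_left (-(Real.log z ^ k / z))
  have h3 : HasSum (fun n : ℕ => -(c ^ (n+1) / ((n:ℝ)+1)) * (z ^ n * Real.log z ^ k))
      (Real.log z ^ k * Real.log (1 - c * z) / z) := by
    convert! hs using 1
    · ext n
      have := h0.ne'
      rw [mul_pow]
      field_simp
      ring
    · ring
  exact h3.tsum_eq.symm

lemma polyLog_one (m : ℕ) : polyLog m 1 = zetaVal m := by
  simp [polyLog, zetaVal]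

lemma M_zeta (k : ℕ) : M k 1 0 = (-1) ^ (k+1) * k.factorial * zetaVal (k+2) := by
  rw [← polyLog_one, ← polyLog_integral k 1 (by simp)]
  simp [M, mm]

lemma M_eta (k : ℕ) : M k 0 1 = (-1) ^ (k+1) * k.factorial * polyLog (k+2) (-1) := by
  rw [← polyLog_integral k (-1) (by simp)]
  simp [M, mm]

lemma Li5_half : EE 3 1 + 3 * Real.log 2 * EE 2 1 + 3 * Real.log 2 ^ 2 * EE 1 1
    + Real.log 2 ^ 3 * EE 0 1 = 6 * polyLog 5 (1/2) := by
  have h := polyLog_integral 3 (1/2) (by rw [abs_of_pos] <;> norm_num)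
  have h6 : (-1:ℝ) ^ (3+1) * (Nat.factorial 3 : ℕ) * polyLog (3+2) (1/2) = 6 * polyLog 5 (1/2) := by
    norm_num [Nat.factorial]
  rw [h6] at h
  rw [← h]
  have himg : (fun y : ℝ => 2 * y) '' Ioo (0:ℝ) (1/2) = Ioo 0 1 := by
    rw [Set.image_mul_left_Ioo (by norm_num)]; norm_num
  rw [← himg, integral_image_eq_integral_abs_deriv_smul (f' := fun _ => 2) measurableSet_Ioo]
  · unfold EE
    rw [← integral_const_mul, ← integral_const_mul, ← integral_const_mul, ← integral_add,
      ← integral_add, ← integral_add]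
    · refine setIntegral_congr_fun measurableSet_Ioo ?_
      rintro y ⟨h0, h1⟩
      have e : Real.log (2 * y) = Real.log 2 + Real.log y := Real.log_mul (by norm_num) h0.ne'
      have e2 : 1 - 1/2 * (2 * y) = 1 - y := by ring
      simp only [e, e2, smul_eq_mul]
      rw [abs_of_pos (by norm_num)]
      field_simp
      ring
    · exact ((EE_int 3 1 le_rfl).add ((EE_int 2 1 le_rfl).const_mul _)).add ((EE_int 1 1 le_rfl).const_mul _)
    · exact (EE_int 0 1 le_rfl).const_mul _
    · exact ((EE_int 3 1 le_rfl).add ((EE_int 2 1 le_rfl).const_mul _))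
    · exact ((EE_int 1 1 le_rfl).const_mul _)
    · exact (EE_int 3 1 le_rfl)
    · exact ((EE_int 2 1 le_rfl).const_mul _)
  · intro x _
    simpa using ((hasDerivAt_id x).const_mul 2).hasDerivWithinAt
  · intro x _ y _ hxy
    simpa using hxy

/-- double sums `∑ 1 / (m ^ s (m+n) ^ r)` -/
noncomputable def ss (r s : ℕ) (p : ℕ × ℕ) : ℝ :=
  1 / (((p.1:ℝ) + 1) ^ s * ((p.1:ℝ) + p.2 + 2) ^ r)

noncomputable def SS (r s : ℕ) : ℝ := ∑' p, ss r s p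

lemma base_summable : Summable fun p : ℕ × ℕ => (1 / ((p.1:ℝ) + 1) ^ 2) * (1 / ((p.2:ℝ) + 1) ^ 2) :=
  (summable_inv_pow 2 le_rfl).mul_of_nonneg (summable_inv_pow 2 le_rfl)
    (fun _ => by positivity) (fun _ => by positivity)

lemma summable_of_denom (d : ℕ × ℕ → ℝ)
    (h : ∀ p : ℕ × ℕ, ((p.1:ℝ) + 1) ^ 2 * ((p.2:ℝ) + 1) ^ 2 ≤ d p) :
    Summable fun p => 1 / d p := by
  refine Summable.of_nonneg_of_le (fun p => ?_) (fun p => ?_) base_summable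
  · have : 0 ≤ d p := le_trans (by positivity) (h p)
    positivity
  · rw [one_div_mul_one_div]
    exact one_div_le_one_div_of_le (by positivity) (h p)

lemma ss_summable (r s : ℕ) (hr : 2 ≤ r) (hs : 1 ≤ s) (h : 4 ≤ r + s) : Summable (ss r s) := by
  refine summable_of_denom _ (fun p => ?_)
  set x : ℝ := (p.1:ℝ) + 1 with hx
  set y : ℝ := (p.2:ℝ) + 1 with hy
  have x1 : 1 ≤ x := by simp [hx]
  have y1 : 1 ≤ y := by simp [hy]
  have e : (p.1:ℝ) + p.2 + 2 = x + y := by rw [hx, hy]; ring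
  rw [e]
  rcases Nat.lt_or_ge s 2 with h2 | h2
  · have : s = 1 := by omega
    subst this
    calc x ^ 2 * y ^ 2 = x ^ 1 * (x * y ^ 2) := by ring
      _ ≤ x ^ 1 * ((x + y) * (x + y) ^ 2) := by gcongr <;> linarith
      _ = x ^ 1 * (x + y) ^ 3 := by ring
      _ ≤ x ^ 1 * (x + y) ^ r := by
        gcongr
        · linarith
        · omega
  · calc x ^ 2 * y ^ 2 ≤ x ^ s * (x + y) ^ 2 := by gcongr; linarith
      _ ≤ _ := by
        gcongr
        linarith

lemma tsum_antidiag (f : ℕ × ℕ → ℝ) (hf : Summable f) :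
    HasSum (fun n => ∑ kl ∈ Finset.HasAntidiagonal.antidiagonal n, f kl) (∑' p, f p) := by
  have h1 : HasSum (f ∘ Finset.HasAntidiagonal.sigmaAntidiagonalEquivProd (A := ℕ)) (∑' p, f p) :=
    (Equiv.hasSum_iff _).2 hf.hasSum
  have h2 := h1.sigma (fun n => hasSum_fintype _)
  convert! h2 using 1
  ext n
  rw [← Finset.sum_attach]
  rfl

lemma SS_harm (r s : ℕ) (hr : 2 ≤ r) (hs : 1 ≤ s) (h : 4 ≤ r + s) :
    HasSum (fun i : ℕ => (1 / ((i:ℝ) + 1) ^ r) * genHarmonic i s) (SS r s) := by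
  have h1 := tsum_antidiag _ (ss_summable r s hr hs h)
  rw [← hasSum_nat_add_iff' 1]
  simp only [Finset.range_one, Finset.sum_singleton, genHarmonic, Finset.range_zero,
    Finset.sum_empty, mul_zero, sub_zero]
  convert! h1 using 1
  ext n
  rw [Finset.mul_sum, Finset.Nat.sum_antidiagonal_eq_sum_range_succ_mk]
  refine Finset.sum_congr rfl fun k hk => ?_
  have hk' : k ≤ n := by simpa [Nat.lt_succ_iff] using hk
  have e : (k:ℝ) + ((n - k : ℕ):ℝ) + 2 = n + 1 + 1 := by
    rw [Nat.cast_sub hk']; ring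
  simp only [ss]
  rw [e, one_div_mul_one_div, mul_comm]
  push_cast
  ring

lemma genHarmonic_succ (k m : ℕ) : genHarmonic (k+1) m = genHarmonic k m + 1 / ((k:ℝ)+1)^m := by
  simp [genHarmonic, Finset.sum_range_succ]

lemma SS_harm_succ (r s : ℕ) (hr : 2 ≤ r) (hs : 1 ≤ s) (h : 4 ≤ r + s) :
    HasSum (fun i : ℕ => (1 / ((i:ℝ) + 1) ^ r) * genHarmonic (i+1) s) (SS r s + zetaVal (r+s)) := by
  have h1 := (SS_harm r s hr hs h).add (summable_inv_pow (r+s) (by omega)).hasSum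
  convert! h1 using 1
  ext i
  rw [genHarmonic_succ, pow_add]
  field_simp

lemma telescope_one (m : ℕ) : HasSum (fun j : ℕ => 1 / ((j:ℝ) + 1 + m) - 1 / ((j:ℝ) + 2 + m))
    (1 / ((m:ℝ) + 1)) := by
  rw [hasSum_iff_tendsto_nat_of_nonneg]
  · have h : ∀ n : ℕ, ∑ j ∈ Finset.range n, (1 / ((j:ℝ) + 1 + m) - 1 / ((j:ℝ) + 2 + m))
        = 1 / ((m:ℝ) + 1) - 1 / ((n:ℝ) + 1 + m) := by
      intro n
      have := Finset.sum_range_sub' (fun j : ℕ => 1 / ((j:ℝ) + 1 + m)) n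
      simp only [Nat.cast_zero, zero_add] at this
      rw [add_comm (m:ℝ) 1, ← this]
      refine Finset.sum_congr rfl fun j _ => ?_
      push_cast
      ring
    simp_rw [h]
    have : Tendsto (fun n : ℕ => 1 / ((n:ℝ) + 1 + m)) atTop (𝓝 0) := by
      have h2 := (tendsto_one_div_add_atTop_nhds_zero_nat (𝕜 := ℝ)).comp (tendsto_add_atTop_nat m)
      refine h2.congr fun n => ?_
      simp; ring
    simpa using this.const_sub (1 / ((m:ℝ) + 1))
  · intro j
    rw [sub_nonneg]
    apply one_div_le_one_div_of_le (by positivity); linarith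

lemma telescope (m : ℕ) : HasSum (fun j : ℕ => 1 / ((j:ℝ) + 1) - 1 / ((j:ℝ) + 1 + m))
    (genHarmonic m 1) := by
  induction m with
  | zero => simp [genHarmonic]
  | succ m ih =>
    rw [genHarmonic_succ, pow_one]
    convert! ih.add (telescope_one m) using 1
    ext j; push_cast; ring

noncomputable def xx (p : ℕ × ℕ) : ℝ :=
  1 / (((p.1:ℝ) + 1) ^ 3 * ((p.2:ℝ) + 1) * ((p.1:ℝ) + p.2 + 2))

lemma xx_summable : Summable xx := by
  refine summable_of_denom _ (fun p => ?_)
  have hx : (0:ℝ) ≤ p.1 := by positivity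
  have hy : (0:ℝ) ≤ p.2 := by positivity
  calc ((p.1:ℝ) + 1) ^ 2 * ((p.2:ℝ) + 1) ^ 2
      = ((p.1:ℝ) + 1) ^ 2 * ((p.2:ℝ) + 1) * ((p.2:ℝ) + 1) := by ring
    _ ≤ ((p.1:ℝ) + 1) ^ 3 * ((p.2:ℝ) + 1) * ((p.1:ℝ) + p.2 + 2) := by
      gcongr ?_ * _ * ?_
      · exact pow_le_pow_right₀ (by linarith) (by norm_num)
      · linarith

lemma xx_tsum : ∑' p, xx p = SS 4 1 + zetaVal 5 := by
  have h := xx_summable.hasSum.prod_fiberwise (g := fun i : ℕ => (1 / ((i:ℝ) + 1) ^ 4) * genHarmonic (i+1) 1) ?_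
  · exact h.unique (SS_harm_succ 4 1 (by norm_num) (by norm_num) (by norm_num))
  · intro i
    have := (telescope (i+1)).mul_left (1 / ((i:ℝ) + 1) ^ 4)
    convert! this using 1
    ext j
    simp only [xx]
    push_cast
    have e : (j:ℝ) + 1 + (i + 1) = i + j + 2 := by ring
    rw [e]
    have : (i:ℝ) + j + 2 ≠ 0 := by positivity
    field_simp
    ring

lemma ss_swap_hasSum : HasSum (fun p : ℕ × ℕ => ss 4 1 p.swap) (SS 4 1) := by
  have := (ss_summable 4 1 (by norm_num) (by norm_num) (by norm_num)).hasSum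
  exact (Equiv.hasSum_iff (Equiv.prodComm ℕ ℕ)).2 this

lemma xx_tsum' : ∑' p, xx p = SS 4 1 + SS 4 1 + SS 3 2 + SS 2 3 := by
  have h := ((ss_swap_hasSum.add (ss_summable 4 1 (by norm_num) (by norm_num) (by norm_num)).hasSum).add
    (ss_summable 3 2 (by norm_num) (by norm_num) (by norm_num)).hasSum).add
    (ss_summable 2 3 (by norm_num) (by norm_num) (by norm_num)).hasSum
  rw [SS, SS, SS] at *
  rw [← h.tsum_eq]
  congr 1
  ext p
  simp only [xx, ss, Prod.fst_swap, Prod.snd_swap]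
  have e : (p.2:ℝ) + p.1 + 2 = p.1 + p.2 + 2 := by ring
  rw [e]
  have : (p.1:ℝ) + p.2 + 2 ≠ 0 := by positivity
  field_simp
  ring

lemma sum_theorem : SS 4 1 + SS 3 2 + SS 2 3 = zetaVal 5 := by
  linarith [xx_tsum, xx_tsum']

lemma zeta_split (i : ℕ) : HasSum (fun j : ℕ => 1 / ((i:ℝ) + j + 2) ^ 3) (zetaVal 3 - genHarmonic (i+1) 3) := by
  have h := (summable_inv_pow 3 (by norm_num)).hasSum
  have h2 := (hasSum_nat_add_iff' (i+1)).2 h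
  convert! h2 using 1
  ext j; push_cast; ring

lemma stuffle : zetaVal 2 * zetaVal 3 = SS 3 2 + SS 2 3 + zetaVal 5 := by
  have h1 := (ss_summable 3 2 (by norm_num) (by norm_num) (by norm_num)).hasSum.prod_fiberwise
    (g := fun i : ℕ => (1 / ((i:ℝ) + 1) ^ 2) * (zetaVal 3 - genHarmonic (i+1) 3)) (fun i => by
      convert! (zeta_split i).mul_left (1 / ((i:ℝ) + 1) ^ 2) using 1
      ext j
      simp only [ss]
      rw [one_div_mul_one_div])
  have h2 := h1.add (SS_harm_succ 2 3 (by norm_num) (by norm_num) (by norm_num))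
  have h3 := (summable_inv_pow 2 le_rfl).hasSum.mul_right (zetaVal 3)
  have h4 := h3.unique (by convert! h2 using 1; ext i; ring)
  have e : (∑' n : ℕ, 1 / ((n:ℝ) + 1) ^ 2) = zetaVal 2 := rfl
  rw [e] at h4
  rw [h4]
  have e2 : (∑' p, ss 3 2 p) = SS 3 2 := rfl
  rw [e2]; ring

lemma SS41 : SS 4 1 = 2 * zetaVal 5 - zetaVal 2 * zetaVal 3 := by
  linarith [sum_theorem, stuffle]

lemma M220_eq : M 2 2 0 = 4 * SS 4 1 := by
  set F : ℕ × ℕ → ℝ → ℝ := fun p y => (1 / (((p.1:ℝ)+1) * ((p.2:ℝ)+1))) * (y ^ (p.1 + p.2 + 1) * Real.log y ^ 2) with hF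
  have hFi : ∀ p, IntegrableOn (F p) (Ioo 0 1) := fun p => (powlog_int _ 2).const_mul _
  have hsum : HasSum (fun p : ℕ × ℕ => 2 * (ss 4 1 p.swap + ss 4 1 p)) (2 * (SS 4 1 + SS 4 1)) :=
    (ss_swap_hasSum.add (ss_summable 4 1 (by norm_num) (by norm_num) (by norm_num)).hasSum).mul_left 2
  have halg : ∀ p : ℕ × ℕ, (1 / (((p.1:ℝ)+1) * ((p.2:ℝ)+1))) * (2 / ((((p.1 + p.2 + 1 : ℕ):ℝ) + 1) ^ 3))
      = 2 * (ss 4 1 p.swap + ss 4 1 p) := by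
    intro p
    simp only [ss, Prod.fst_swap, Prod.snd_swap]
    push_cast
    have e : (p.2:ℝ) + p.1 + 2 = p.1 + p.2 + 2 := by ring
    have e' : (p.1:ℝ) + p.2 + 1 + 1 = p.1 + p.2 + 2 := by ring
    rw [e, e']
    have : (p.1:ℝ) + p.2 + 2 ≠ 0 := by positivity
    field_simp
    ring
  have hI : ∀ p, ∫ y in Ioo (0:ℝ) 1, F p y = 2 * (ss 4 1 p.swap + ss 4 1 p) := by
    intro p
    rw [← halg]
    simp only [hF]
    rw [integral_const_mul, powlog_integral]
    norm_num
  have hN : ∀ p, ∫ y in Ioo (0:ℝ) 1, ‖F p y‖ = 2 * (ss 4 1 p.swap + ss 4 1 p) := by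
    intro p
    rw [← halg]
    simp only [hF]
    simp_rw [norm_mul (1 / (((p.1:ℝ)+1) * ((p.2:ℝ)+1)))]
    rw [integral_const_mul, powlog_norm_integral, Real.norm_of_nonneg (by positivity)]
    norm_num
  have h := hasSum_integral_of_summable_integral_norm hFi (by simp_rw [hN]; exact hsum.summable)
  simp_rw [hI] at h
  have h2 := h.unique hsum
  have h3 : M 2 2 0 = ∫ y in Ioo (0:ℝ) 1, ∑' p, F p y := by
    unfold M
    refine setIntegral_congr_fun measurableSet_Ioo ?_
    rintro y ⟨h0, h1⟩
    have hy : |y| < 1 := by rw [abs_of_pos h0]; exact h1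
    have a := Real.hasSum_pow_div_log_of_abs_lt_one hy
    have b := (a.mul a (a.summable.mul_of_nonneg a.summable (fun n => by positivity)
      (fun n => by positivity))).mul_left (Real.log y ^ 2 / y)
    have c : HasSum (fun p => F p y) (mm 2 2 0 y) := by
      convert! b using 1
      · ext p
        have := h0.ne'
        simp only [hF]
        field_simp
        ring
      · simp only [mm]; ring
    exact c.tsum_eq.symm
  rw [h3, h2]; ring

lemma ser (c : ℕ → ℂ) (F : ℂ → ℂ) (hF : ∀ w : ℂ, ‖w‖ < 1 → HasSum (fun n => c n * w ^ n) (F w))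
    (g : ℝ → ℝ) (hg : Continuous g) (r : ℝ) (h0 : 0 ≤ r) (h1 : r < 1) :
    HasSum (fun n : ℕ => c n * (r:ℂ) ^ n * ((∫ x in (0:ℝ)..(π/2), g x * (2 * Real.cos (2 * n * x)) : ℝ) : ℂ))
      (∫ x in (0:ℝ)..(π/2), (g x : ℂ) * (F (r * Complex.exp (2 * x * Complex.I))
        + F (r * Complex.exp (-(2 * x * Complex.I))))) := by
  have hs : Summable fun n : ℕ => ‖c n * (r:ℂ) ^ n‖ := by
    have := (hF (r:ℂ) (by rw [Complex.norm_real, Real.norm_eq_abs, abs_of_nonneg h0]; exact h1)).summable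
    exact this.norm
  have ne : ∀ x : ℝ, ‖Complex.exp (2 * x * Complex.I)‖ = 1 := by
    intro x
    have := Complex.norm_exp_ofReal_mul_I (2 * x)
    simpa using this
  have ne' : ∀ x : ℝ, ‖Complex.exp (-(2 * x * Complex.I))‖ = 1 := by
    intro x
    have := Complex.norm_exp_ofReal_mul_I (-(2 * x))
    simpa using this
  have key := intervalIntegral.hasSum_integral_of_dominated_convergence (μ := volume) (a := 0) (b := π/2)
    (F := fun (n : ℕ) (x : ℝ) => (g x : ℂ) * (c n * (r * Complex.exp (2 * x * Complex.I)) ^ n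
        + c n * (r * Complex.exp (-(2 * x * Complex.I))) ^ n))
    (f := fun x : ℝ => (g x : ℂ) * (F (r * Complex.exp (2 * x * Complex.I))
        + F (r * Complex.exp (-(2 * x * Complex.I)))))
    (fun n x => ‖c n * (r:ℂ) ^ n‖ * (2 * |g x|))
    (fun n => by
      apply Continuous.aestronglyMeasurable
      fun_prop)
    (fun n => ae_of_all _ fun x _ => by
      rw [norm_mul, Complex.norm_real, Real.norm_eq_abs, mul_comm, ← mul_assoc]
      apply mul_le_mul_of_nonneg_right _ (abs_nonneg _)
      refine (norm_add_le _ _).trans ?_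
      rw [mul_pow, mul_pow, ← mul_assoc, ← mul_assoc, norm_mul, norm_mul _ (Complex.exp _ ^ n), norm_pow, norm_pow, ne, ne']
      apply le_of_eq; simp; ring)
    (ae_of_all _ fun x _ => hs.mul_right _)
    (by
      simp_rw [tsum_mul_right]
      apply Continuous.intervalIntegrable
      fun_prop)
    (ae_of_all _ fun x _ => by
      apply HasSum.mul_left
      apply HasSum.add
      · apply hF; rw [norm_mul, ne, Complex.norm_real, Real.norm_eq_abs, abs_of_nonneg h0]; simpa using h1
      · apply hF; rw [norm_mul, ne', Complex.norm_real, Real.norm_eq_abs, abs_of_nonneg h0]; simpa using h1)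
  refine Eq.mp (congrArg (fun f => HasSum f _) (funext fun n => ?_)) key
  symm
  rw [← intervalIntegral.integral_ofReal, ← intervalIntegral.integral_const_mul]
  congr 1
  ext x
  push_cast
  rw [Complex.cos, mul_pow, mul_pow, ← Complex.exp_nat_mul, ← Complex.exp_nat_mul]
  have e1 : (2 * (n:ℂ) * x * Complex.I) = n * (2 * x * Complex.I) := by ring
  have e2 : (-(2 * (n:ℂ) * x) * Complex.I) = n * -(2 * x * Complex.I) := by ring
  rw [e1, e2]; ring

lemma gam1 (n : ℕ) : ∫ x in (0:ℝ)..(π/2), (2 * x) * (2 * Real.cos (2 * (n+1 : ℕ) * x))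
    = ((-1) ^ (n+1) - 1) / ((n:ℝ)+1) ^ 2 := by
  have hn : ((n:ℝ)+1) ≠ 0 := by positivity
  rw [intervalIntegral.integral_eq_sub_of_hasDerivAt
    (f := fun x => 2 * x * Real.sin (2 * ((n:ℝ)+1) * x) / ((n:ℝ)+1) + Real.cos (2 * ((n:ℝ)+1) * x) / ((n:ℝ)+1)^2)]
  · have e : 2 * ((n:ℝ)+1) * (π/2) = (n+1 : ℕ) * π := by push_cast; ring
    rw [e, Real.sin_nat_mul_pi, Real.cos_nat_mul_pi]
    simp; ring
  · intro x _
    have h1 : HasDerivAt (fun x : ℝ => 2 * ((n:ℝ)+1) * x) (2 * ((n:ℝ)+1)) x := by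
      simpa using (hasDerivAt_id x).const_mul (2 * ((n:ℝ)+1))
    have h2 : HasDerivAt (fun x : ℝ => 2 * x) 2 x := by simpa using (hasDerivAt_id x).const_mul 2
    refine HasDerivAt.congr_deriv (((h2.mul h1.sin).div_const ((n:ℝ)+1)).add (h1.cos.div_const (((n:ℝ)+1)^2))) ?_
    push_cast
    field_simp
    ring
  · apply Continuous.intervalIntegrable; fun_prop

lemma gam1_zero : ∫ x in (0:ℝ)..(π/2), (2 * x) * (2 * Real.cos (2 * (0 : ℕ) * x)) = π^2/2 := by
  have : ∀ x : ℝ, (2 * x) * (2 * Real.cos (2 * (0 : ℕ) * x)) = 4 * x := by intro x; simp; ring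
  simp_rw [this]
  rw [intervalIntegral.integral_const_mul, integral_id]; ring

lemma gam2 (n : ℕ) : ∫ x in (0:ℝ)..(π/2), (x^2*(π/2-x)) * (2 * Real.cos (2 * (n+1 : ℕ) * x))
    = -(π^2/8) * ((-1) ^ (n+1) / ((n:ℝ)+1) ^ 2) + 3/4 * (((-1)^(n+1) - 1) / ((n:ℝ)+1)^4) := by
  have hn : ((n:ℝ)+1) ≠ 0 := by positivity
  rw [intervalIntegral.integral_eq_sub_of_hasDerivAt
    (f := fun x => (x^2*(π/2-x)) * Real.sin (2 * ((n:ℝ)+1) * x) / ((n:ℝ)+1)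
      + (π*x-3*x^2) * Real.cos (2 * ((n:ℝ)+1) * x) / (2*((n:ℝ)+1)^2)
      - (π-6*x) * Real.sin (2 * ((n:ℝ)+1) * x) / (4*((n:ℝ)+1)^3)
      + 6 * Real.cos (2 * ((n:ℝ)+1) * x) / (8*((n:ℝ)+1)^4))]
  · have e : 2 * ((n:ℝ)+1) * (π/2) = (n+1 : ℕ) * π := by push_cast; ring
    rw [e, Real.sin_nat_mul_pi, Real.cos_nat_mul_pi]
    simp; field_simp; ring
  · intro x _
    have h1 : HasDerivAt (fun x : ℝ => 2 * ((n:ℝ)+1) * x) (2 * ((n:ℝ)+1)) x := by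
      simpa using (hasDerivAt_id x).const_mul (2 * ((n:ℝ)+1))
    have p1 : HasDerivAt (fun x : ℝ => x^2*(π/2-x)) (π*x-3*x^2) x := by
      have := ((hasDerivAt_id x).pow 2).mul ((hasDerivAt_id x).const_sub (π/2))
      refine this.congr_deriv ?_; simp; ring
    have p2 : HasDerivAt (fun x : ℝ => π*x-3*x^2) (π-6*x) x := by
      have := ((hasDerivAt_id x).const_mul π).sub (((hasDerivAt_id x).pow 2).const_mul 3)
      refine this.congr_deriv ?_; simp; ring
    have p3 : HasDerivAt (fun x : ℝ => π-6*x) (-6) x := by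
      have := ((hasDerivAt_id x).const_mul 6).const_sub π
      refine this.congr_deriv ?_; simp
    refine HasDerivAt.congr_deriv (((((p1.mul h1.sin).div_const ((n:ℝ)+1)).add ((p2.mul h1.cos).div_const (2*((n:ℝ)+1)^2))).sub
       ((p3.mul h1.sin).div_const (4*((n:ℝ)+1)^3))).add ((h1.cos.const_mul 6).div_const (8*((n:ℝ)+1)^4))) ?_
    push_cast
    field_simp
    ring
  · apply Continuous.intervalIntegrable; fun_prop

lemma radial (c : ℕ → ℂ) (F : ℂ → ℂ) (hF : ∀ w : ℂ, ‖w‖ < 1 → HasSum (fun n => c n * w ^ n) (F w))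
    (r : ℝ) (h0 : 0 ≤ r) (h1 : r < 1) :
    (∫ x in (0:ℝ)..(π/2), ((2 * x : ℝ) : ℂ) * (F (r * Complex.exp (2 * x * Complex.I))
        + F (r * Complex.exp (-(2 * x * Complex.I))))) =
    F 0 * ((π^2/2 : ℝ) : ℂ) + ∫ t in Ioo (0:ℝ) 1, ((Real.log t / t : ℝ) : ℂ) * (F ((r * t : ℝ)) - F ((-(r * t) : ℝ))) := by
  have hs : Summable fun n : ℕ => ‖c n * (r:ℂ) ^ n‖ := by
    have := (hF (r:ℂ) (by rw [Complex.norm_real, Real.norm_eq_abs, abs_of_nonneg h0]; exact h1)).summable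
    exact this.norm
  have hF0 : F 0 = c 0 := by
    have h := hF 0 (by simp)
    have h2 := hasSum_single (f := fun n => c n * (0:ℂ) ^ n) 0 (fun n hn => by simp [hn])
    simpa using h.unique h2
  have A := ser c F hF (fun x => 2 * x) (by fun_prop) r h0 h1
  have A' := (hasSum_nat_add_iff' 1).mpr A
  simp only [Finset.sum_range_one, gam1, gam1_zero, pow_zero, mul_one] at A'
  set d : ℕ → ℂ := fun n => c (n+1) * (r:ℂ)^(n+1) * (1 - (-1)^(n+1)) with hd
  have hI : ∀ n : ℕ, ∫ t in Ioo (0:ℝ) 1, d n * ((t ^ n * Real.log t ^ 1 : ℝ) : ℂ)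
      = c (n+1) * (r:ℂ)^(n+1) * ((((-1) ^ (n+1) - 1) / ((n:ℝ)+1) ^ 2 : ℝ) : ℂ) := by
    intro n
    rw [integral_const_mul, integral_complex_ofReal, powlog_integral, hd]
    push_cast
    simp
    ring
  have hN : ∀ n : ℕ, ∫ t in Ioo (0:ℝ) 1, ‖d n * ((t ^ n * Real.log t ^ 1 : ℝ) : ℂ)‖
      = ‖d n‖ * (1 / ((n:ℝ)+1)^2) := by
    intro n
    simp_rw [norm_mul (d n), Complex.norm_real]
    rw [integral_const_mul, powlog_norm_integral]; simp
  have hS : Summable fun n : ℕ => ∫ t in Ioo (0:ℝ) 1, ‖d n * ((t ^ n * Real.log t ^ 1 : ℝ) : ℂ)‖ := by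
    simp_rw [hN]
    have hs1 : Summable fun n : ℕ => ‖c (n+1) * (r:ℂ) ^ (n+1)‖ := (summable_nat_add_iff 1).mpr hs
    refine Summable.of_nonneg_of_le (fun n => by positivity) (fun n => ?_) (hs1.mul_left 2)
    have e1 : ‖d n‖ ≤ 2 * ‖c (n+1) * (r:ℂ) ^ (n+1)‖ := by
      rw [hd]; simp only; rw [norm_mul, mul_comm]
      gcongr
      refine (norm_sub_le _ _).trans ?_
      simp; norm_num
    have e2 : 1 / ((n:ℝ)+1)^2 ≤ 1 := by
      rw [div_le_one (by positivity)]; nlinarith [(Nat.cast_nonneg n : (0:ℝ) ≤ n)]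
    calc ‖d n‖ * (1 / ((n:ℝ)+1)^2) ≤ ‖d n‖ * 1 := by gcongr
      _ ≤ _ := by rw [mul_one]; exact e1
  have B := hasSum_integral_of_summable_integral_norm
    (fun n : ℕ => (((powlog_int n 1).ofReal (𝕜 := ℂ)).const_mul (d n))) hS
  have hI' : ∀ n : ℕ, (∫ t in Ioo (0:ℝ) 1, d n * ((RCLike.ofReal (t ^ n * Real.log t ^ 1 : ℝ)) : ℂ))
      = c (n+1) * (r:ℂ)^(n+1) * ((((-1) ^ (n+1) - 1) / ((n:ℝ)+1) ^ 2 : ℝ) : ℂ) := hI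
  simp_rw [hI'] at B
  have C := A'.unique B
  rw [sub_eq_iff_eq_add] at C
  rw [C, hF0, add_comm]
  congr 1
  refine setIntegral_congr_fun measurableSet_Ioo ?_
  rintro t ⟨t0, t1⟩
  have hrt : |r * t| < 1 := by
    rw [abs_mul, abs_of_pos t0, abs_of_nonneg h0]; nlinarith
  have f1 := hF ((r*t : ℝ)) (by rw [Complex.norm_real]; exact hrt)
  have f2 := hF ((-(r*t) : ℝ)) (by rw [Complex.norm_real, norm_neg]; exact hrt)
  have f3 := (hasSum_nat_add_iff' 1).mpr (f1.sub f2)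
  simp only [Finset.sum_range_one, pow_zero, mul_one, sub_self, sub_zero] at f3
  have f4 := f3.mul_left ((Real.log t / t : ℝ) : ℂ)
  have f5 : (fun n : ℕ => d n * ((RCLike.ofReal (t ^ n * Real.log t ^ 1 : ℝ)) : ℂ)) =
     (fun n : ℕ => ((Real.log t / t : ℝ) : ℂ) * (c (n+1) * ((r*t : ℝ):ℂ)^(n+1) - c (n+1) * ((-(r*t) : ℝ):ℂ)^(n+1))) := by
    ext n
    have ht : (t:ℂ) ≠ 0 := by exact_mod_cast t0.ne'
    simp only [hd]
    have : ((RCLike.ofReal (t ^ n * Real.log t ^ 1 : ℝ)) : ℂ) = (((t ^ n * Real.log t ^ 1 : ℝ)) : ℂ) := rfl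
    rw [this]
    push_cast
    rw [neg_pow ((r:ℂ)*t)]
    field_simp
    ring
  simp only
  rw [f5, f4.tsum_eq]

noncomputable def DD (x : ℝ) : ℝ := (1 + |Real.log (Real.sin (2 * x))|) ^ 3

lemma sin_two_lower (x : ℝ) (h0 : 0 < x) (h1 : x < π/2) :
    0 < Real.sin (2 * x) ∧ (Real.sin (2*x)) ^ (-(1/2:ℝ)) ≤ domD (2/π * x) := by
  have hpi := Real.pi_pos
  have hs : 0 < Real.sin (2*x) := Real.sin_pos_of_pos_of_lt_pi (by linarith) (by linarith)
  refine ⟨hs, ?_⟩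
  set z := 2/π * x with hz
  have hz0 : 0 < z := by positivity
  have hz1 : z < 1 := by rw [hz, div_mul_eq_mul_div, div_lt_one hpi]; linarith
  have a1 : z ≤ Real.sin x := Real.mul_le_sin h0.le h1.le
  have a2 : 1 - z ≤ Real.cos x := Real.one_sub_mul_le_cos h0.le h1.le
  have a3 : 2 * z * (1 - z) ≤ Real.sin (2*x) := by
    rw [Real.sin_two_mul]
    nlinarith [mul_le_mul a1 a2 (by linarith) (by linarith)]
  unfold domD
  have p1 : 0 ≤ z ^ (-(1/2:ℝ)) := by positivity
  have p2 : 0 ≤ (1-z) ^ (-(1/2:ℝ)) := Real.rpow_nonneg (by linarith) _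
  rcases le_total z (1/2) with h | h
  · have : Real.sin (2*x) ^ (-(1/2:ℝ)) ≤ z ^ (-(1/2:ℝ)) :=
      Real.rpow_le_rpow_of_nonpos hz0 (by nlinarith) (by norm_num)
    linarith
  · have : Real.sin (2*x) ^ (-(1/2:ℝ)) ≤ (1-z) ^ (-(1/2:ℝ)) :=
      Real.rpow_le_rpow_of_nonpos (by linarith) (by nlinarith) (by norm_num)
    linarith

lemma DD_int : IntervalIntegrable DD volume 0 (π/2) := by
  have hpi := Real.pi_pos
  have hd : IntervalIntegrable domD volume 0 1 := by
    rw [intervalIntegrable_iff_integrableOn_Ioo_of_le (by norm_num)]; exact integrableOn_domD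
  have hd2 := (hd.comp_mul_left (c := 2/π)).const_mul ((Nat.factorial 3 * 2^3 * Real.exp (1/2) : ℝ))
  have e : 1 / (2/π) = π/2 := by field_simp
  rw [e, zero_div] at hd2
  rw [intervalIntegrable_iff_integrableOn_Ioo_of_le (by positivity)] at hd2 ⊢
  refine Integrable.mono' hd2 (Measurable.aestronglyMeasurable (by unfold DD; fun_prop)) ?_
  filter_upwards [ae_restrict_mem measurableSet_Ioo] with x hx
  obtain ⟨s0, hs⟩ := sin_two_lower x hx.1 hx.2
  have := one_add_abslog_pow_le s0 (Real.sin_le_one _) 3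
  unfold DD
  rw [Real.norm_of_nonneg (by positivity)]
  refine this.trans ?_
  gcongr

lemma circ (e : ℂ) (he : ‖e‖ = 1) (r : ℝ) : |e.im| ≤ ‖1 - r * e‖ := by
  refine abs_le_of_sq_le_sq ?_ (norm_nonneg _)
  rw [Complex.sq_norm, Complex.normSq_apply]
  have h : e.re * e.re + e.im * e.im = 1 := by
    rw [← Complex.normSq_apply, ← Complex.sq_norm, he]; norm_num
  simp
  nlinarith [sq_nonneg (e.re - r)]

lemma log_norm_bound (z : ℂ) (s : ℝ) (h0 : 0 < s) (h1 : s ≤ 1) (hz : s ≤ ‖z‖) (hz2 : ‖z‖ ≤ 2) :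
    ‖Complex.log z‖ ≤ 4 * (1 + |Real.log s|) ∧ ‖Complex.log z - (Real.log 2 : ℝ)‖ ≤ 5 * (1 + |Real.log s|) := by
  have hl2 : Real.log 2 < 0.6931471808 := Real.log_two_lt_d9
  have hl2' : 0 < Real.log 2 := Real.log_pos (by norm_num)
  have hpi := Real.pi_lt_d2
  have a1 : |Real.log ‖z‖| ≤ Real.log 2 + |Real.log s| := by
    have u1 := Real.log_le_log h0 hz
    have u2 := Real.log_le_log (by linarith) hz2
    rw [abs_le]
    constructor
    · have := neg_abs_le (Real.log s); linarith
    · have := abs_nonneg (Real.log s); linarith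
  have a2 : ‖Complex.log z‖ ≤ |Real.log ‖z‖| + π := by
    refine (Complex.norm_le_abs_re_add_abs_im _).trans ?_
    rw [Complex.log_re, Complex.log_im]
    gcongr
    exact Complex.abs_arg_le_pi z
  have hs := abs_nonneg (Real.log s)
  constructor
  · linarith
  · refine (norm_sub_le _ _).trans ?_
    rw [Complex.norm_real, Real.norm_of_nonneg hl2'.le]
    linarith

lemma circ_limit (G : ℂ → ℂ) (K : ℝ) (hK : 0 ≤ K) (g : ℝ → ℝ) (hg : Continuous g)
    (hD : ContinuousOn G (Metric.ball 0 1))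
    (hC : ∀ e : ℂ, ‖e‖ = 1 → e.im ≠ 0 → ContinuousAt G e)
    (hB : ∀ e : ℂ, ‖e‖ = 1 → e.im ≠ 0 → ∀ r : ℝ, 0 ≤ r → r < 1 → ‖G (r * e)‖ ≤ K * (1 + |Real.log (|e.im|)|)^3) :
    Tendsto (fun r : ℝ => ∫ x in (0:ℝ)..(π/2), (g x : ℂ) * (G (r * Complex.exp (2 * x * Complex.I))
        + G (r * Complex.exp (-(2 * x * Complex.I))))) (𝓝[<] 1)
     (𝓝 (∫ x in (0:ℝ)..(π/2), (g x : ℂ) * (G (Complex.exp (2 * x * Complex.I))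
        + G (Complex.exp (-(2 * x * Complex.I)))))) := by
  have hpi := Real.pi_pos
  have ne : ∀ x : ℝ, ‖Complex.exp (2 * x * Complex.I)‖ = 1 := by
    intro x
    have := Complex.norm_exp_ofReal_mul_I (2 * x)
    simpa using this
  have ne' : ∀ x : ℝ, ‖Complex.exp (-(2 * x * Complex.I))‖ = 1 := by
    intro x
    have := Complex.norm_exp_ofReal_mul_I (-(2 * x))
    simpa using this
  have im1 : ∀ x : ℝ, (Complex.exp (2 * x * Complex.I)).im = Real.sin (2*x) := by
    intro x
    have := Complex.exp_ofReal_mul_I_im (2 * x)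
    simpa using this
  have im2 : ∀ x : ℝ, (Complex.exp (-(2 * x * Complex.I))).im = - Real.sin (2*x) := by
    intro x
    have := Complex.exp_ofReal_mul_I_im (-(2 * x))
    simpa using this
  have hev : ∀ᶠ r : ℝ in 𝓝[<] 1, r ∈ Ioo (0:ℝ) 1 := Ioo_mem_nhdsLT (by norm_num)
  have hae : ∀ᵐ x : ℝ, x ≠ π/2 := compl_mem_ae_iff.mpr (measure_singleton _)
  refine intervalIntegral.tendsto_integral_filter_of_dominated_convergence
    (fun x => |g x| * (2 * K * DD x)) ?_ ?_ ?_ ?_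
  · filter_upwards [hev] with r hr
    apply Continuous.aestronglyMeasurable
    refine Continuous.mul (by fun_prop) (Continuous.add ?_ ?_)
    · refine hD.comp_continuous (by fun_prop) (fun x => ?_)
      rw [mem_ball_zero_iff, norm_mul, ne, Complex.norm_real, Real.norm_of_nonneg hr.1.le]; simpa using hr.2
    · refine hD.comp_continuous (by fun_prop) (fun x => ?_)
      rw [mem_ball_zero_iff, norm_mul, ne', Complex.norm_real, Real.norm_of_nonneg hr.1.le]; simpa using hr.2
  · filter_upwards [hev] with r hr
    filter_upwards [hae] with x hx hx2
    rw [uIoc_of_le (by positivity)] at hx2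
    obtain ⟨s0, _⟩ := sin_two_lower x hx2.1 (lt_of_le_of_ne hx2.2 hx)
    have b1 := hB _ (ne x) (by rw [im1]; exact s0.ne') r hr.1.le hr.2
    have b2 := hB _ (ne' x) (by rw [im2]; exact neg_ne_zero.mpr s0.ne') r hr.1.le hr.2
    rw [im1, abs_of_pos s0] at b1
    rw [im2, abs_neg, abs_of_pos s0] at b2
    rw [norm_mul, Complex.norm_real, Real.norm_eq_abs]
    gcongr
    refine (norm_add_le _ _).trans ?_
    unfold DD
    linarith
  · exact (DD_int.const_mul _).continuousOn_mul (by fun_prop)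
  · filter_upwards [hae] with x hx hx2
    rw [uIoc_of_le (by positivity)] at hx2
    obtain ⟨s0, _⟩ := sin_two_lower x hx2.1 (lt_of_le_of_ne hx2.2 hx)
    have c1 := hC _ (ne x) (by rw [im1]; exact s0.ne')
    have c2 := hC _ (ne' x) (by rw [im2]; exact neg_ne_zero.mpr s0.ne')
    have t : ∀ e : ℂ, Tendsto (fun r : ℝ => (r:ℂ) * e) (𝓝[<] 1) (𝓝 e) := by
      intro e
      have : Tendsto (fun r : ℝ => (r:ℂ) * e) (𝓝 1) (𝓝 (((1:ℝ):ℂ) * e)) := by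
        apply Continuous.tendsto; fun_prop
      simp only [Complex.ofReal_one, one_mul] at this
      exact this.mono_left nhdsWithin_le_nhds
    exact tendsto_const_nhds.mul ((c1.tendsto.comp (t _)).add (c2.tendsto.comp (t _)))

lemma exp_eq_of (z : ℂ) (ρ θ : ℝ) (hρ : 0 < ρ) (h1 : -π < θ) (h2 : θ ≤ π)
    (hre : z.re = ρ * Real.cos θ) (him : z.im = ρ * Real.sin θ) :
    Complex.log z = (Real.log ρ : ℝ) + (θ:ℝ) * Complex.I := by
  have : z = Complex.exp ((Real.log ρ : ℝ) + (θ:ℝ) * Complex.I) := by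
    rw [Complex.exp_add, ← Complex.ofReal_exp, Real.exp_log hρ]
    apply Complex.ext
    · rw [Complex.re_ofReal_mul, Complex.exp_ofReal_mul_I_re, hre]
    · rw [Complex.im_ofReal_mul, Complex.exp_ofReal_mul_I_im, him]
  rw [this, Complex.log_exp]
  · simpa using h1
  · simpa using h2

lemma ere (x : ℝ) : (Complex.exp (2 * x * Complex.I)).re = Real.cos (2*x) := by
  have := Complex.exp_ofReal_mul_I_re (2 * x)
  simpa using this
lemma eim (x : ℝ) : (Complex.exp (2 * x * Complex.I)).im = Real.sin (2*x) := by
  have := Complex.exp_ofReal_mul_I_im (2 * x)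
  simpa using this
lemma ere' (x : ℝ) : (Complex.exp (-(2 * x * Complex.I))).re = Real.cos (2*x) := by
  have := Complex.exp_ofReal_mul_I_re (-(2 * x))
  simpa using this
lemma eim' (x : ℝ) : (Complex.exp (-(2 * x * Complex.I))).im = -Real.sin (2*x) := by
  have := Complex.exp_ofReal_mul_I_im (-(2 * x))
  simpa using this

lemma bd_facts (x : ℝ) (h0 : 0 < x) (h1 : x < π/2) :
    Complex.log (1 - Complex.exp (2 * x * Complex.I)) = (Real.log (2 * Real.sin x) : ℝ) + ((x - π/2 : ℝ)) * Complex.I ∧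
    Complex.log (1 - Complex.exp (-(2 * x * Complex.I))) = (Real.log (2 * Real.sin x) : ℝ) + ((-(x - π/2) : ℝ)) * Complex.I ∧
    Complex.log (1 + Complex.exp (2 * x * Complex.I)) = (Real.log (2 * Real.cos x) : ℝ) + (x : ℝ) * Complex.I ∧
    Complex.log (1 + Complex.exp (-(2 * x * Complex.I))) = (Real.log (2 * Real.cos x) : ℝ) + ((-x : ℝ)) * Complex.I := by
  have hs : 0 < Real.sin x := Real.sin_pos_of_pos_of_lt_pi h0 (by linarith)
  have hc : 0 < Real.cos x := Real.cos_pos_of_mem_Ioo ⟨by linarith, h1⟩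
  have hcs := Real.sin_sq_add_cos_sq x
  have e2 := Real.cos_two_mul x
  have e3 := Real.sin_two_mul x
  refine ⟨exp_eq_of _ _ _ (by positivity) (by linarith) (by linarith) ?_ ?_,
    exp_eq_of _ _ _ (by positivity) (by linarith) (by linarith) ?_ ?_,
    exp_eq_of _ _ _ (by positivity) (by linarith) (by linarith) ?_ ?_,
    exp_eq_of _ _ _ (by positivity) (by linarith) (by linarith) ?_ ?_⟩
  · rw [Complex.sub_re, ere, Real.cos_sub_pi_div_two, Complex.one_re]; nlinarith
  · rw [Complex.sub_im, eim, Real.sin_sub_pi_div_two, Complex.one_im]; nlinarith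
  · rw [Complex.sub_re, ere', Real.cos_neg, Real.cos_sub_pi_div_two, Complex.one_re]; nlinarith
  · rw [Complex.sub_im, eim', Real.sin_neg, Real.sin_sub_pi_div_two, Complex.one_im]; nlinarith
  · rw [Complex.add_re, ere, Complex.one_re]; nlinarith
  · rw [Complex.add_im, eim, Complex.one_im]; nlinarith
  · rw [Complex.add_re, ere', Real.cos_neg, Complex.one_re]; nlinarith
  · rw [Complex.add_im, eim', Real.sin_neg, Complex.one_im]; nlinarith

lemma slit_sub (w : ℂ) (h : ‖w‖ < 1) : 1 - w ∈ Complex.slitPlane := by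
  left; have := (Complex.abs_re_le_norm w).trans_lt h
  rw [abs_lt] at this; simp; linarith [this.2]

lemma slit_add (w : ℂ) (h : ‖w‖ < 1) : 1 + w ∈ Complex.slitPlane := by
  have := slit_sub (-w) (by simpa using h); simpa using this

lemma slit_im_sub (e : ℂ) (h : e.im ≠ 0) : 1 - e ∈ Complex.slitPlane := by
  right; simpa using h
lemma slit_im_add (e : ℂ) (h : e.im ≠ 0) : 1 + e ∈ Complex.slitPlane := by
  right; simpa using h

lemma circ_bounds (e : ℂ) (he : ‖e‖ = 1) (hi : e.im ≠ 0) (r : ℝ) (h0 : 0 ≤ r) (h1 : r < 1) :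
    ‖Complex.log (1 - r * e)‖ ≤ 4 * (1 + |Real.log (|e.im|)|) ∧
    ‖Complex.log (1 - r * e) - (Real.log 2 : ℝ)‖ ≤ 5 * (1 + |Real.log (|e.im|)|) := by
  have hs : 0 < |e.im| := abs_pos.mpr hi
  have hs1 : |e.im| ≤ 1 := he ▸ Complex.abs_im_le_norm e
  refine log_norm_bound _ _ hs hs1 (circ e he r) ?_
  refine (norm_sub_le _ _).trans ?_
  rw [norm_mul, he, Complex.norm_real, Real.norm_of_nonneg h0]
  simp; linarith

lemma I3_limit : Tendsto (fun r : ℝ => ∫ x in (0:ℝ)..(π/2), ((x^2*(π/2-x) : ℝ) : ℂ) *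
      (Complex.log (1 - r * Complex.exp (2 * x * Complex.I)) + Complex.log (1 - r * Complex.exp (-(2 * x * Complex.I)))))
      (𝓝[<] 1) (𝓝 ((2 * ∫ x in (0:ℝ)..(π/2), x^2*(π/2-x) * Real.log (2 * Real.sin x) : ℝ) : ℂ)) := by
  have := circ_limit (fun w => Complex.log (1 - w)) 4 (by norm_num) (fun x => x^2*(π/2-x)) (by fun_prop)
    (by
      intro w hw
      apply ContinuousAt.continuousWithinAt
      apply ContinuousAt.clog (by fun_prop)
      exact slit_sub w (by simpa using hw))
    (by
      intro e he hi
      apply ContinuousAt.clog (by fun_prop)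
      exact slit_im_sub e hi)
    (by
      intro e he hi r h0 h1
      refine (circ_bounds e he hi r h0 h1).1.trans ?_
      gcongr
      apply le_self_pow₀ _ (by norm_num)
      linarith [abs_nonneg (Real.log (|e.im|))])
  refine Eq.mp (congrArg (fun z => Tendsto _ _ (𝓝 z)) ?_) this
  rw [← intervalIntegral.integral_const_mul, ← intervalIntegral.integral_ofReal]
  have hae : ∀ᵐ x : ℝ, x ≠ π/2 := compl_mem_ae_iff.mpr (measure_singleton _)
  apply intervalIntegral.integral_congr_ae
  filter_upwards [hae] with x hx hx2
  rw [uIoc_of_le (by positivity)] at hx2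
  obtain ⟨b1, b2, -, -⟩ := bd_facts x hx2.1 (lt_of_le_of_ne hx2.2 hx)
  simp only [b1, b2]
  push_cast; ring

lemma I3 : 2 * ∫ x in (0:ℝ)..(π/2), x^2*(π/2-x) * Real.log (2 * Real.sin x) =
    π^2/8 * polyLog 3 (-1) - 3/4 * (polyLog 5 (-1) - zetaVal 5) := by
  set γ : ℕ → ℝ := fun n => ∫ x in (0:ℝ)..(π/2), (x^2*(π/2-x)) * (2 * Real.cos (2 * n * x)) with hγ
  set c : ℕ → ℂ := fun n => -(1 / (n:ℂ)) with hc
  have hF : ∀ w : ℂ, ‖w‖ < 1 → HasSum (fun n => c n * w ^ n) (Complex.log (1 - w)) := by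
    intro w hw
    have := (Complex.hasSum_taylorSeries_neg_log hw).neg
    rw [neg_neg] at this
    refine Eq.mp (congrArg (fun f => HasSum f _) (funext fun n => ?_)) this
    rw [hc]; ring
  have hS := fun r h0 h1 => (ser c (fun w => Complex.log (1 - w)) hF (fun x => x^2*(π/2-x)) (by fun_prop) r h0 h1).tsum_eq
  have hp : ∀ m : ℕ, 2 ≤ m → Summable fun k : ℕ => (-1:ℝ) ^ (k+1) / ((k:ℝ)+1) ^ m := by
    intro m hm
    refine Summable.of_norm_bounded (summable_inv_pow m hm) (fun k => ?_)
    rw [norm_div, norm_pow]; simp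
    rw [abs_of_nonneg (by positivity)]
  have hpl : ∀ m : ℕ, 2 ≤ m → HasSum (fun k : ℕ => (-1:ℝ) ^ (k+1) / ((k:ℝ)+1) ^ m) (polyLog m (-1)) :=
    fun m hm => (hp m hm).hasSum
  have hz : HasSum (fun k : ℕ => 1 / ((k:ℝ)+1) ^ 5) (zetaVal 5) := (summable_inv_pow 5 (by norm_num)).hasSum
  have hsum : HasSum (fun n : ℕ => -(1/((n:ℝ)+1)) * γ (n+1)) (π^2/8 * polyLog 3 (-1) - 3/4 * (polyLog 5 (-1) - zetaVal 5)) := by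
    have := ((hpl 3 (by norm_num)).mul_left (π^2/8)).sub (((hpl 5 (by norm_num)).sub hz).mul_left (3/4))
    refine Eq.mp (congrArg (fun f => HasSum f _) (funext fun n => ?_)) this
    simp only [hγ]
    rw [gam2 n]
    field_simp
    ring
  have hsumC : HasSum (fun n : ℕ => c n * (γ n : ℂ)) ((π^2/8 * polyLog 3 (-1) - 3/4 * (polyLog 5 (-1) - zetaVal 5) : ℝ) : ℂ) := by
    rw [← hasSum_nat_add_iff' 1]
    simp only [Finset.sum_range_one, hc, Nat.cast_zero, div_zero, neg_zero, zero_mul, sub_zero]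
    have := Complex.hasSum_ofReal.mpr hsum
    refine Eq.mp (congrArg (fun f => HasSum f _) (funext fun n => ?_)) this
    push_cast; ring
  have hlim : Tendsto (fun r : ℝ => ∑' n : ℕ, c n * (r:ℂ)^n * (γ n : ℂ)) (𝓝[<] 1) (𝓝 (∑' n : ℕ, c n * (γ n : ℂ))) := by
    refine tendsto_tsum_of_dominated_convergence hsumC.summable.norm ?_ ?_
    · intro n
      have : Tendsto (fun r : ℝ => c n * (r:ℂ)^n * (γ n : ℂ)) (𝓝 1) (𝓝 (c n * ((1:ℝ):ℂ)^n * (γ n : ℂ))) := by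
        apply Continuous.tendsto; fun_prop
      simp only [Complex.ofReal_one, one_pow, mul_one] at this
      exact this.mono_left nhdsWithin_le_nhds
    · filter_upwards [Ioo_mem_nhdsLT (show (0:ℝ) < 1 by norm_num)] with r hr n
      rw [norm_mul, norm_mul, norm_mul, norm_pow, Complex.norm_real r, Real.norm_of_nonneg hr.1.le]
      gcongr
      exact mul_le_of_le_one_right (norm_nonneg _) (pow_le_one₀ hr.1.le hr.2.le)
  rw [hsumC.tsum_eq] at hlim
  have hlim2 := I3_limit
  have hE : (fun r : ℝ => ∑' n : ℕ, c n * (r:ℂ)^n * (γ n : ℂ)) =ᶠ[𝓝[<] 1] (fun r : ℝ => ∫ x in (0:ℝ)..(π/2), ((x^2*(π/2-x) : ℝ) : ℂ) *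
      (Complex.log (1 - r * Complex.exp (2 * x * Complex.I)) + Complex.log (1 - r * Complex.exp (-(2 * x * Complex.I))))) := by
    filter_upwards [Ioo_mem_nhdsLT (show (0:ℝ) < 1 by norm_num)] with r hr
    exact hS r hr.1.le hr.2
  have := tendsto_nhds_unique hlim2 (hlim.congr' hE)
  exact_mod_cast this

noncomputable def FF (w : ℂ) : ℂ :=
  (Complex.log (1 - w) - (Real.log 2 : ℝ)) ^ 2 * (Complex.log (1 + w) - (Real.log 2 : ℝ))

lemma FF_real (t : ℝ) (h : |t| < 1) :
    FF (t : ℝ) = (((Real.log (1 - t) - Real.log 2)^2 * (Real.log (1+t) - Real.log 2) : ℝ) : ℂ) := by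
  rw [abs_lt] at h
  unfold FF
  have e1 : Complex.log (1 - (t:ℂ)) = (Real.log (1-t) : ℝ) := by
    rw [Complex.ofReal_log (by linarith)]; push_cast; rfl
  have e2 : Complex.log (1 + (t:ℂ)) = (Real.log (1+t) : ℝ) := by
    rw [Complex.ofReal_log (by linarith)]; push_cast; rfl
  rw [e1, e2]; push_cast; ring

lemma FF_diff (w : ℂ) (h1 : 1 - w ∈ Complex.slitPlane) (h2 : 1 + w ∈ Complex.slitPlane) : DifferentiableAt ℂ FF w := by
  unfold FF
  refine DifferentiableAt.mul (DifferentiableAt.pow (DifferentiableAt.sub_const (DifferentiableAt.clog (by fun_prop) h1) _) _)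
    (DifferentiableAt.sub_const (DifferentiableAt.clog (by fun_prop) h2) _)

lemma FF_series : ∃ c : ℕ → ℂ, ∀ w : ℂ, ‖w‖ < 1 → HasSum (fun n => c n * w ^ n) (FF w) := by
  refine ⟨fun n => (n.factorial : ℂ)⁻¹ * iteratedDeriv n FF 0, fun w hw => ?_⟩
  have hd : DifferentiableOn ℂ FF (Metric.ball 0 1) := by
    intro z hz
    rw [mem_ball_zero_iff] at hz
    exact (FF_diff z (slit_sub z hz) (slit_add z hz)).differentiableWithinAt
  have := Complex.hasSum_taylorSeries_on_ball (r := 1) hd (z := w) (by simpa using hw)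
  refine Eq.mp (congrArg (fun f => HasSum f _) (funext fun n => ?_)) this
  simp only [smul_eq_mul, sub_zero]; ring

lemma FF_circ : Tendsto (fun r : ℝ => ∫ x in (0:ℝ)..(π/2), ((2 * x : ℝ) : ℂ) *
      (FF (r * Complex.exp (2 * x * Complex.I)) + FF (r * Complex.exp (-(2 * x * Complex.I)))))
      (𝓝[<] 1) (𝓝 ((∫ x in (0:ℝ)..(π/2), 4 * x * ((Real.log (Real.sin x) ^2 - (x-π/2)^2) * Real.log (Real.cos x)
        - 2 * Real.log (Real.sin x) * (x - π/2) * x) : ℝ) : ℂ)) := by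
  have := circ_limit FF 125 (by norm_num) (fun x => 2 * x) (by fun_prop)
    (by
      intro w hw
      rw [mem_ball_zero_iff] at hw
      exact (FF_diff w (slit_sub w hw) (slit_add w hw)).continuousAt.continuousWithinAt)
    (by
      intro e he hi
      exact (FF_diff e (slit_im_sub e hi) (slit_im_add e hi)).continuousAt)
    (by
      intro e he hi r h0 h1
      have b1 := (circ_bounds e he hi r h0 h1).2
      have b2 := (circ_bounds (-e) (by simpa using he) (by simpa using hi) r h0 h1).2
      rw [Complex.neg_im, abs_neg, mul_neg, sub_neg_eq_add] at b2
      unfold FF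
      rw [norm_mul, norm_pow]
      calc _ ≤ (5 * (1 + |Real.log (|e.im|)|))^2 * (5 * (1 + |Real.log (|e.im|)|)) := by gcongr
        _ = _ := by ring)
  refine Eq.mp (congrArg (fun z => Tendsto _ _ (𝓝 z)) ?_) this
  rw [← intervalIntegral.integral_ofReal]
  have hae : ∀ᵐ x : ℝ, x ≠ π/2 := compl_mem_ae_iff.mpr (measure_singleton _)
  apply intervalIntegral.integral_congr_ae
  filter_upwards [hae] with x hx hx2
  rw [uIoc_of_le (by positivity)] at hx2
  have hx3 := lt_of_le_of_ne hx2.2 hx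
  have hs : 0 < Real.sin x := Real.sin_pos_of_pos_of_lt_pi hx2.1 (by linarith [Real.pi_pos])
  have hc : 0 < Real.cos x := Real.cos_pos_of_mem_Ioo ⟨by linarith [hx2.1], hx3⟩
  obtain ⟨b1, b2, b3, b4⟩ := bd_facts x hx2.1 hx3
  unfold FF
  simp only [b1, b2, b3, b4]
  rw [Real.log_mul (by norm_num) hs.ne', Real.log_mul (by norm_num) hc.ne']
  push_cast
  have hI : Complex.I ^ 2 = -1 := Complex.I_sq
  set a : ℂ := ((Real.log (Real.sin x) : ℝ) : ℂ)
  set b : ℂ := ((Real.log (Real.cos x) : ℝ) : ℂ)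
  linear_combination (2 * (x:ℂ)) * (2 * ((x:ℂ) - π/2)^2 * b + 4 * a * ((x:ℂ) - π/2) * x) * hI

lemma FF_rad : Tendsto (fun r : ℝ => ∫ t in Ioo (0:ℝ) 1, ((Real.log t / t : ℝ) : ℂ) * (FF ((r * t : ℝ)) - FF ((-(r * t) : ℝ))))
     (𝓝[<] 1) (𝓝 ((∫ t in Ioo (0:ℝ) 1, Real.log t / t * ((Real.log (1-t) - Real.log 2) * (Real.log (1+t) - Real.log 2)
       * (Real.log (1-t) - Real.log (1+t))) : ℝ) : ℂ)) := by
  have hL : 0 < Real.log 2 := Real.log_pos (by norm_num)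
  have hT : Tendsto (fun r : ℝ => ∫ t in Ioo (0:ℝ) 1, Real.log t / t * ((Real.log (1-r*t) - Real.log 2) * (Real.log (1+r*t) - Real.log 2)
       * (Real.log (1-r*t) - Real.log (1+r*t)))) (𝓝[<] 1) (𝓝 (∫ t in Ioo (0:ℝ) 1, Real.log t / t * ((Real.log (1-t) - Real.log 2) * (Real.log (1+t) - Real.log 2)
       * (Real.log (1-t) - Real.log (1+t))))) := by
    refine tendsto_integral_filter_of_dominated_convergence
      (fun t => -(Real.log 2 * mm 1 0 2 t - 2 * Real.log 2 * mm 1 1 1 t + Real.log 2 ^2 * mm 1 0 1 t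
        - Real.log 2^2 * mm 1 1 0 t - mm 1 1 2 t + mm 1 2 1 t + Real.log 2 * mm 1 2 0 t)) ?_ ?_ ?_ ?_
    · filter_upwards with r
      exact Measurable.aestronglyMeasurable (by fun_prop)
    · filter_upwards [Ioo_mem_nhdsLT (show (0:ℝ) < 1 by norm_num)] with r hr
      filter_upwards [ae_restrict_mem measurableSet_Ioo] with t ht
      obtain ⟨t0, t1⟩ := ht
      have hrt0 : 0 < r * t := mul_pos hr.1 t0
      have hrt : r * t ≤ t := by nlinarith [hr.2]
      have l0 : Real.log t ≤ 0 := Real.log_nonpos t0.le t1.le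
      have p1 : Real.log (1-t) ≤ Real.log (1-r*t) := Real.log_le_log (by linarith) (by linarith)
      have p2 : Real.log (1-r*t) ≤ 0 := Real.log_nonpos (by linarith) (by linarith)
      have q1 : Real.log (1+r*t) ≤ Real.log (1+t) := Real.log_le_log (by linarith) (by linarith)
      have q2 : 0 ≤ Real.log (1+r*t) := Real.log_nonneg (by linarith)
      rw [norm_mul, norm_mul, norm_mul, norm_div, Real.norm_eq_abs, Real.norm_eq_abs, Real.norm_eq_abs, Real.norm_eq_abs, Real.norm_eq_abs,
        abs_of_nonpos l0, abs_of_pos t0]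
      have u1 : |Real.log (1-r*t) - Real.log 2| ≤ Real.log 2 - Real.log (1-t) := by rw [abs_le]; constructor <;> linarith
      have u2 : |Real.log (1+r*t) - Real.log 2| ≤ Real.log (1+t) + Real.log 2 := by rw [abs_le]; constructor <;> linarith
      have u3 : |Real.log (1-r*t) - Real.log (1+r*t)| ≤ Real.log (1+t) - Real.log (1-t) := by rw [abs_le]; constructor <;> linarith
      have hl : 0 ≤ -Real.log t / t := by apply div_nonneg <;> linarith
      calc _ ≤ -Real.log t / t * ((Real.log 2 - Real.log (1-t)) * (Real.log (1+t) + Real.log 2) * (Real.log (1+t) - Real.log (1-t))) := by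
            apply mul_le_mul_of_nonneg_left _ hl
            apply mul_le_mul _ u3 (abs_nonneg _) (mul_nonneg (by linarith) (by linarith))
            exact mul_le_mul u1 u2 (abs_nonneg _) (by linarith)
        _ = _ := by unfold mm; ring
    · exact (((((((mm_int 1 0 2 (by norm_num)).const_mul _).sub ((mm_int 1 1 1 (by norm_num)).const_mul _)).add
        ((mm_int 1 0 1 (by norm_num)).const_mul _)).sub ((mm_int 1 1 0 (by norm_num)).const_mul _)).sub
        (mm_int 1 1 2 (by norm_num))).add (mm_int 1 2 1 (by norm_num)) |>.add ((mm_int 1 2 0 (by norm_num)).const_mul _)).neg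
    · filter_upwards [ae_restrict_mem measurableSet_Ioo] with t ht
      obtain ⟨t0, t1⟩ := ht
      have c1 : ContinuousAt (fun r : ℝ => Real.log (1-r*t)) 1 :=
        ContinuousAt.log (by fun_prop) (by linarith)
      have c2 : ContinuousAt (fun r : ℝ => Real.log (1+r*t)) 1 :=
        ContinuousAt.log (by fun_prop) (by linarith)
      have : ContinuousAt (fun r : ℝ => Real.log t / t * ((Real.log (1-r*t) - Real.log 2) * (Real.log (1+r*t) - Real.log 2)
       * (Real.log (1-r*t) - Real.log (1+r*t)))) 1 := by fun_prop
      have h := this.tendsto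
      simp only [one_mul] at h
      exact h.mono_left nhdsWithin_le_nhds
  have hT2 := (Complex.continuous_ofReal.tendsto _).comp hT
  refine hT2.congr' ?_
  filter_upwards [Ioo_mem_nhdsLT (show (0:ℝ) < 1 by norm_num)] with r hr
  simp only [Function.comp]
  rw [← integral_complex_ofReal]
  refine setIntegral_congr_fun measurableSet_Ioo ?_
  rintro t ⟨t0, t1⟩
  have hrt : |r * t| < 1 := by
    rw [abs_of_pos (mul_pos hr.1 t0)]; nlinarith [hr.2, hr.1]
  simp only
  rw [FF_real _ hrt, FF_real _ (by rwa [abs_neg])]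
  rw [sub_neg_eq_add, ← sub_eq_add_neg]
  push_cast; ring

lemma rad_val : ∫ t in Ioo (0:ℝ) 1, Real.log t / t * ((Real.log (1-t) - Real.log 2) * (Real.log (1+t) - Real.log 2)
       * (Real.log (1-t) - Real.log (1+t))) = (M 1 2 1 - M 1 1 2) - Real.log 2 * (M 1 2 0 - M 1 0 2)
        + Real.log 2^2 * (M 1 1 0 - M 1 0 1) := by
  unfold M
  have i1 := mm_int 1 2 1 (by norm_num)
  have i2 := mm_int 1 1 2 (by norm_num)
  have i3 := mm_int 1 2 0 (by norm_num)
  have i4 := mm_int 1 0 2 (by norm_num)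
  have i5 := mm_int 1 1 0 (by norm_num)
  have i6 := mm_int 1 0 1 (by norm_num)
  have j1 : IntegrableOn (fun t => mm 1 2 1 t - mm 1 1 2 t) (Ioo 0 1) := i1.sub i2
  have j2 : IntegrableOn (fun t => Real.log 2 * (mm 1 2 0 t - mm 1 0 2 t)) (Ioo 0 1) := (i3.sub i4).const_mul _
  have j3 : IntegrableOn (fun t => Real.log 2 ^ 2 * (mm 1 1 0 t - mm 1 0 1 t)) (Ioo 0 1) := (i5.sub i6).const_mul _
  have j4 : IntegrableOn (fun t => (mm 1 2 1 t - mm 1 1 2 t) - Real.log 2 * (mm 1 2 0 t - mm 1 0 2 t)) (Ioo 0 1) := j1.sub j2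
  rw [← integral_sub i1 i2, ← integral_sub i3 i4, ← integral_sub i5 i6, ← integral_const_mul, ← integral_const_mul,
    ← integral_sub j1 j2, ← integral_add j4 j3]
  congr 1
  ext t
  unfold mm
  simp
  ring

lemma contour : ∫ x in (0:ℝ)..(π/2), 4 * x * ((Real.log (Real.sin x) ^2 - (x-π/2)^2) * Real.log (Real.cos x)
        - 2 * Real.log (Real.sin x) * (x - π/2) * x) = -Real.log 2 ^ 3 * (π^2/2) + ((M 1 2 1 - M 1 1 2) - Real.log 2 * (M 1 2 0 - M 1 0 2)
        + Real.log 2^2 * (M 1 1 0 - M 1 0 1)) := by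
  obtain ⟨c, hc⟩ := FF_series
  have h0 : FF 0 = ((-Real.log 2 ^ 3 : ℝ) : ℂ) := by
    have := FF_real 0 (by simp)
    rw [Complex.ofReal_zero] at this
    rw [this]; congr 1; simp only [sub_zero, add_zero, Real.log_one]; ring
  have h1 : Tendsto (fun r : ℝ => ∫ x in (0:ℝ)..(π/2), ((2 * x : ℝ) : ℂ) *
      (FF (r * Complex.exp (2 * x * Complex.I)) + FF (r * Complex.exp (-(2 * x * Complex.I)))))
      (𝓝[<] 1) (𝓝 _) := (FF_rad.const_add (FF 0 * ((π^2/2 : ℝ) : ℂ))).congr' (by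
    filter_upwards [Ioo_mem_nhdsLT (show (0:ℝ) < 1 by norm_num)] with r hr
    exact (radial c FF hc r hr.1.le hr.2).symm)
  have h2 := tendsto_nhds_unique FF_circ h1
  rw [h0, rad_val] at h2
  exact_mod_cast h2

lemma loc_int : IntervalIntegrable (fun x => x * (Real.log (Real.sin x))^2 * Real.log (Real.cos x)) volume 0 (π/2) := by
  have hd := DD_int.const_mul (π/2)
  rw [intervalIntegrable_iff_integrableOn_Ioo_of_le (by positivity)] at hd ⊢
  refine Integrable.mono' hd (Measurable.aestronglyMeasurable (by fun_prop)) ?_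
  filter_upwards [ae_restrict_mem measurableSet_Ioo] with x hx
  have hs : 0 < Real.sin x := Real.sin_pos_of_pos_of_lt_pi hx.1 (by linarith [hx.2, Real.pi_pos])
  have hc : 0 < Real.cos x := Real.cos_pos_of_mem_Ioo ⟨by linarith [hx.1, Real.pi_pos], hx.2⟩
  have hs1 := Real.sin_le_one x
  have hc1 := Real.cos_le_one x
  have e3 := Real.sin_two_mul x
  obtain ⟨s0, _⟩ := sin_two_lower x hx.1 hx.2
  have hL : Real.log 2 < 0.6931471808 := Real.log_two_lt_d9
  have g1 : Real.log (Real.sin (2*x)) ≤ Real.log 2 + Real.log (Real.sin x) := by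
    rw [← Real.log_mul (by norm_num) hs.ne']
    exact Real.log_le_log s0 (by nlinarith)
  have g2 : Real.log (Real.sin (2*x)) ≤ Real.log 2 + Real.log (Real.cos x) := by
    rw [← Real.log_mul (by norm_num) hc.ne']
    exact Real.log_le_log s0 (by nlinarith)
  have k1 : |Real.log (Real.sin x)| ≤ 1 + |Real.log (Real.sin (2*x))| := by
    rw [abs_of_nonpos (Real.log_nonpos hs.le hs1)]
    linarith [neg_abs_le (Real.log (Real.sin (2*x)))]
  have k2 : |Real.log (Real.cos x)| ≤ 1 + |Real.log (Real.sin (2*x))| := by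
    rw [abs_of_nonpos (Real.log_nonpos hc.le hc1)]
    linarith [neg_abs_le (Real.log (Real.sin (2*x)))]
  rw [norm_mul, norm_mul, norm_pow, Real.norm_eq_abs, Real.norm_eq_abs, Real.norm_eq_abs, abs_of_pos hx.1]
  unfold DD
  calc _ ≤ π/2 * (1 + |Real.log (Real.sin (2*x))|)^2 * (1 + |Real.log (Real.sin (2*x))|) := by
        gcongr
        exact hx.2.le
    _ = _ := by ring

lemma contour2 : 4 * (∫ x in (0:ℝ)..(π/2), x * (Real.log (Real.sin x))^2 * Real.log (Real.cos x))
    + 4 * (∫ x in (0:ℝ)..(π/2), x^2*(π/2-x) * Real.log (Real.sin x))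
   = -Real.log 2 ^ 3 * (π^2/2) + ((M 1 2 1 - M 1 1 2) - Real.log 2 * (M 1 2 0 - M 1 0 2)
        + Real.log 2^2 * (M 1 1 0 - M 1 0 1)) := by
  rw [← contour]
  have s1 : IntervalIntegrable (fun x => x^2*(π/2-x) * Real.log (Real.sin x)) volume 0 (π/2) :=
    (intervalIntegrable_log_sin).continuousOn_mul (by fun_prop)
  have s2 : IntervalIntegrable (fun x => x*(x-π/2)^2 * Real.log (Real.cos x)) volume 0 (π/2) :=
    (intervalIntegrable_log_cos).continuousOn_mul (by fun_prop)
  have r : ∫ x in (0:ℝ)..(π/2), x*(x-π/2)^2 * Real.log (Real.cos x) = ∫ x in (0:ℝ)..(π/2), x^2*(π/2-x) * Real.log (Real.sin x) := by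
    have := intervalIntegral.integral_comp_sub_left (a := 0) (b := π/2) (fun x => x*(x-π/2)^2 * Real.log (Real.cos x)) (π/2)
    simp only [sub_self, sub_zero, Real.cos_pi_div_two_sub] at this
    rw [← this]
    congr 1
    ext x; ring
  have : ∀ x : ℝ, 4 * x * ((Real.log (Real.sin x) ^2 - (x-π/2)^2) * Real.log (Real.cos x)
        - 2 * Real.log (Real.sin x) * (x - π/2) * x) = 4 * (x * (Real.log (Real.sin x))^2 * Real.log (Real.cos x))
      - 4 * (x*(x-π/2)^2 * Real.log (Real.cos x)) + 8 * (x^2*(π/2-x) * Real.log (Real.sin x)) := by intro x; ring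
  simp_rw [this]
  rw [intervalIntegral.integral_add ((loc_int.const_mul 4).sub (s2.const_mul 4)) (s1.const_mul 8),
    intervalIntegral.integral_sub (loc_int.const_mul 4) (s2.const_mul 4), intervalIntegral.integral_const_mul,
    intervalIntegral.integral_const_mul, intervalIntegral.integral_const_mul, r]
  ring

lemma I3' : ∫ x in (0:ℝ)..(π/2), x^2*(π/2-x) * Real.log (Real.sin x) =
   π^2/16 * polyLog 3 (-1) - 3/8 * (polyLog 5 (-1) - zetaVal 5) - Real.log 2 * π^4/192 := by
  have s1 : IntervalIntegrable (fun x => x^2*(π/2-x) * Real.log (Real.sin x)) volume 0 (π/2) :=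
    (intervalIntegrable_log_sin).continuousOn_mul (by fun_prop)
  have s2 : IntervalIntegrable (fun x : ℝ => Real.log 2 * (x^2*(π/2-x))) volume 0 (π/2) :=
    Continuous.intervalIntegrable (by fun_prop) _ _
  have e : ∫ x in (0:ℝ)..(π/2), x^2*(π/2-x) * Real.log (2 * Real.sin x) = (∫ x in (0:ℝ)..(π/2), Real.log 2 * (x^2*(π/2-x)))
      + ∫ x in (0:ℝ)..(π/2), x^2*(π/2-x) * Real.log (Real.sin x) := by
    rw [← intervalIntegral.integral_add s2 s1]
    apply intervalIntegral.integral_congr_ae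
    refine ae_of_all _ fun x hx => ?_
    rw [uIoc_of_le (by positivity)] at hx
    have hs : 0 < Real.sin x := Real.sin_pos_of_pos_of_lt_pi hx.1 (by linarith [hx.2, Real.pi_pos])
    rw [Real.log_mul (by norm_num) hs.ne']; ring
  have e2 : ∫ x in (0:ℝ)..(π/2), Real.log 2 * (x^2*(π/2-x)) = Real.log 2 * (π^4/192) := by
    rw [intervalIntegral.integral_const_mul]
    congr 1
    have : ∀ x : ℝ, x^2*(π/2-x) = π/2 * x^2 - x^3 := by intro x; ring
    simp_rw [this]
    rw [intervalIntegral.integral_sub (Continuous.intervalIntegrable (by fun_prop) _ _) (Continuous.intervalIntegrable (by fun_prop) _ _),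
      intervalIntegral.integral_const_mul, integral_pow, integral_pow]
    norm_num; ring
  have := I3
  linarith

lemma pi_sq : π^2 = 6 * zetaVal 2 := by
  have h := hasSum_zeta_two
  rw [← hasSum_nat_add_iff' 1] at h
  have := h.tsum_eq
  simp at this
  have e : zetaVal 2 = π^2/6 := by
    unfold zetaVal; rw [← this]; congr 1; ext n; simp
  linarith

lemma pi_four : π^4 = 90 * zetaVal 4 := by
  have h := hasSum_zeta_four
  rw [← hasSum_nat_add_iff' 1] at h
  have := h.tsum_eq
  simp at this
  have e : zetaVal 4 = π^4/90 := by
    unfold zetaVal; rw [← this]; congr 1; ext n; simp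
  linarith

lemma W1 (b c : ℕ) (h : 1 ≤ b) : WW 1 b c = EE (c+1) b + GG (c+1) b - (EE c (b+1) + GG c (b+1)) := by
  rw [WW_succ 0 b c h, WW_zero _ _ h, WW_zero _ _ (by omega)]
lemma W2 (b c : ℕ) (h : 1 ≤ b) : WW 2 b c = WW 1 b (c+1) - WW 1 (b+1) c := WW_succ 1 b c h
lemma W3 (b c : ℕ) (h : 1 ≤ b) : WW 3 b c = WW 2 b (c+1) - WW 2 (b+1) c := WW_succ 2 b c h

lemma final_alg (I J L : ℝ) (hL : L = Real.log 2)
    (hc : 4 * I + 4 * J = -L ^ 3 * (π^2/2) + ((M 1 2 1 - M 1 1 2) - L * (M 1 2 0 - M 1 0 2) + L^2 * (M 1 1 0 - M 1 0 1)))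
    (hJ : J = π^2/16 * polyLog 3 (-1) - 3/8 * (polyLog 5 (-1) - zetaVal 5) - L * π^4/192) :
    I = -(155 / 128) * zetaVal 5 - 1 / 32 * zetaVal 2 * zetaVal 3 + polyLog 5 (1 / 2)
      + 49 / 32 * L * zetaVal 4 - 2 / 3 * L ^ 3 * zetaVal 2 - 1 / 120 * L ^ 5 := by
  have z0 : M 0 1 0 = - zetaVal 2 := by have := M_zeta 0; norm_num at this; linarith
  have z1 : M 1 1 0 = zetaVal 3 := by have := M_zeta 1; norm_num at this; linarith
  have z2 : M 2 1 0 = -2 * zetaVal 4 := by have := M_zeta 2; norm_num [Nat.factorial] at this; linarith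
  have z3 : M 3 1 0 = 6 * zetaVal 5 := by have := M_zeta 3; norm_num [Nat.factorial] at this; linarith
  have q0 : M 0 0 1 = zetaVal 2 / 2 := by have := M_sq_one 0; norm_num at this; linarith
  have q1 : M 1 0 1 = -3/4 * zetaVal 3 := by have := M_sq_one 1; norm_num at this; linarith
  have q2 : M 2 0 1 = 7/4 * zetaVal 4 := by have := M_sq_one 2; norm_num at this; linarith
  have q3 : M 3 0 1 = -(15/16) * 6 * zetaVal 5 := by have := M_sq_one 3; norm_num at this; linarith
  have p3 : polyLog 3 (-1) = -3/4 * zetaVal 3 := by have := M_eta 1; norm_num at this; linarith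
  have p5 : polyLog 5 (-1) = -15/16 * zetaVal 5 := by have := M_eta 3; norm_num [Nat.factorial] at this; linarith
  have B : M 2 2 0 = 8 * zetaVal 5 - 4 * (zetaVal 2 * zetaVal 3) := by rw [M220_eq, SS41]; ring
  have s2 : M 2 2 0 = 8 * (M 2 2 0 + 2 * M 2 1 1 + M 2 0 2) := by have := M_sq_two 2; norm_num at this; linarith
  have mo := M_moebius
  have li := Li5_half
  rw [← hL] at li
  have hl : -Real.log 2 = -L := by rw [hL]
  -- weight five
  have i31 : 3 * EE 2 2 - 2 * GG 3 1 = -L^5 := by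
    have := IBP 3 1 (by norm_num); norm_num at this; rw [hl] at this; linear_combination this
  have i22 : 2 * EE 1 3 - 3 * GG 2 2 = -L^5 := by
    have := IBP 2 2 (by norm_num); norm_num at this; rw [hl] at this; linear_combination this
  have i13 : EE 0 4 - 4 * GG 1 3 = -L^5 := by
    have := IBP 1 3 (by norm_num); norm_num at this; rw [hl] at this; linear_combination this
  have i04 : -5 * GG 0 4 = -L^5 := by
    have := IBP 0 4 (by norm_num); norm_num at this; rw [hl] at this; linear_combination this
  have r31 := M_refl 3 1 (by norm_num) (by norm_num)
  have r22 := M_refl 2 2 (by norm_num) (by norm_num)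
  have r13 := M_refl 1 3 (by norm_num) (by norm_num)
  have m301 : M 3 0 1 = -(EE 3 1 - 3 * EE 2 2 + 3 * EE 1 3 - EE 0 4 + GG 3 1 - 3 * GG 2 2 + 3 * GG 1 3 - GG 0 4) := by
    rw [M_sub, W3 _ _ (by norm_num), W2 _ _ (by norm_num), W2 _ _ (by norm_num), W1 _ _ (by norm_num), W1 _ _ (by norm_num),
      W1 _ _ (by norm_num)]
    norm_num; ring
  have m202 : M 2 0 2 = EE 2 2 - 2 * EE 1 3 + EE 0 4 + GG 2 2 - 2 * GG 1 3 + GG 0 4 := by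
    rw [M_sub, W2 _ _ (by norm_num), W1 _ _ (by norm_num), W1 _ _ (by norm_num)]
    norm_num; ring
  have m103 : M 1 0 3 = -(EE 1 3 - EE 0 4 + GG 1 3 - GG 0 4) := by
    rw [M_sub, W1 _ _ (by norm_num)]; norm_num; ring
  -- weight four
  have i21 : 2 * EE 1 2 - 2 * GG 2 1 = L^4 := by
    have := IBP 2 1 (by norm_num); norm_num at this; rw [← hL] at this; linear_combination this
  have i12 : EE 0 3 - 3 * GG 1 2 = L^4 := by
    have := IBP 1 2 (by norm_num); norm_num at this; rw [← hL] at this; linear_combination this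
  have i03 : -4 * GG 0 3 = L^4 := by
    have := IBP 0 3 (by norm_num); norm_num at this; rw [← hL] at this; linear_combination this
  have r21 := M_refl 2 1 (by norm_num) (by norm_num)
  have r12 := M_refl 1 2 (by norm_num) (by norm_num)
  have m201 : M 2 0 1 = -(EE 2 1 - 2 * EE 1 2 + EE 0 3 + GG 2 1 - 2 * GG 1 2 + GG 0 3) := by
    rw [M_sub, W2 _ _ (by norm_num), W1 _ _ (by norm_num), W1 _ _ (by norm_num)]
    norm_num; ring
  have m102 : M 1 0 2 = EE 1 2 - EE 0 3 + GG 1 2 - GG 0 3 := by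
    rw [M_sub, W1 _ _ (by norm_num)]; norm_num; ring
  -- weight three
  have i11 : EE 0 2 - 2 * GG 1 1 = -L^3 := by
    have := IBP 1 1 (by norm_num); norm_num at this; rw [hl] at this; linear_combination this
  have i02 : -3 * GG 0 2 = -L^3 := by
    have := IBP 0 2 (by norm_num); norm_num at this; rw [hl] at this; linear_combination this
  have r11 := M_refl 1 1 (by norm_num) (by norm_num)
  have m101 : M 1 0 1 = -(EE 1 1 - EE 0 2 + GG 1 1 - GG 0 2) := by
    rw [M_sub, W1 _ _ (by norm_num)]; norm_num; ring
  -- weight two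
  have i01 : -2 * GG 0 1 = L^2 := by
    have := IBP 0 1 (by norm_num); norm_num at this; rw [← hL] at this; linear_combination this
  have m001 : M 0 0 1 = -(EE 0 1 + GG 0 1) := by
    rw [M_sub, WW_zero _ _ (by norm_num)]; norm_num
  have t0 : EE 0 1 = -zetaVal 2 / 2 + L^2/2 := by linarith
  have t1 : EE 1 1 = 7/8 * zetaVal 3 - L^3/3 := by linarith
  have R3 : M 1 1 0 - M 1 0 1 = 7/4 * zetaVal 3 := by linarith
  have R4 : M 1 2 0 - M 1 0 2 = -(17/4) * zetaVal 4 + L^4/2 - 2 * EE 2 1 := by linarith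
  have R5 : M 1 2 1 - M 1 1 2 = 5/16 * (8 * zetaVal 5 - 4 * (zetaVal 2 * zetaVal 3)) - 71/16 * zetaVal 5
      + 2/3 * EE 3 1 + 2/15 * L^5 := by linarith
  rw [t0, t1] at li
  rw [R3, R4, R5, pi_sq] at hc
  rw [p3, p5, pi_sq, pi_four] at hJ
  linear_combination hc / 4 - hJ + li / 6

end Helpers

theorem stmt_9 :
    ∫ x in (0 : ℝ)..(π / 2), x * (Real.log (Real.sin x)) ^ 2 * Real.log (Real.cos x)
    = -(155 / 128) * zetaVal 5 - 1 / 32 * zetaVal 2 * zetaVal 3 + polyLog 5 (1 / 2)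
      + 49 / 32 * Real.log 2 * zetaVal 4 - 2 / 3 * Real.log 2 ^ 3 * zetaVal 2 - 1 / 120 * Real.log 2 ^ 5 := by
  exact final_alg _ _ _ rfl contour2 I3'
end

section
/- ∫_0^{π/2} x cot(x) ln^2(cos(x)) dx = −(3π/16)ζ(3) + (π^3/24) ln(2) + (π/6) ln^3(2). -/
open Real

lemma cont_aux1 {u : ℂ} (hu : u ∈ Complex.slitPlane) :
    ContinuousAt (fun u : ℂ => u * Complex.log u ^ 3 / (u - 1)) u := by
  have e : (fun u : ℂ => u * Complex.log u ^ 3 / (u - 1)) =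
      fun u => u * Complex.log u ^ 2 * dslope Complex.log 1 u := by
    funext u
    have h := sub_smul_dslope Complex.log 1 u
    by_cases h1 : u = 1
    · simp [h1]
    · have : u - 1 ≠ 0 := sub_ne_zero.mpr h1
      simp at h
      rw [← h]
      field_simp
  rw [e]
  have hl : ContinuousAt Complex.log u := Complex.differentiableAt_log hu |>.continuousAt
  have hd : ContinuousAt (dslope Complex.log 1) u := by
    by_cases h1 : u = 1
    · subst h1
      exact continuousAt_dslope_same.mpr (Complex.differentiableAt_log hu)
    · exact (continuousAt_dslope_of_ne h1).mpr hl
  fun_prop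

lemma cont_aux0 :
    ContinuousAt (fun u : ℂ => u * Complex.log u ^ 3 / (u - 1)) 0 := by
  have key : Filter.Tendsto (fun r : ℝ => (r ^ (1/3 : ℝ) * (|Real.log r| + π)) ^ 3)
      (nhdsWithin 0 (Set.Ioi 0)) (nhds 0) := by
    have h1 := (tendsto_log_mul_rpow_nhdsGT_zero (r := 1/3) (by norm_num)).abs
    have h2 : Filter.Tendsto (fun r : ℝ => r ^ (1/3 : ℝ) * π) (nhdsWithin 0 (Set.Ioi 0)) (nhds 0) := by
      have : ContinuousAt (fun r : ℝ => r ^ (1/3 : ℝ) * π) 0 :=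
        (Real.continuousAt_rpow_const 0 (1/3) (Or.inr (by norm_num))).mul continuousAt_const
      have h := this.tendsto
      simp at h
      simpa using h.mono_left nhdsWithin_le_nhds
    have h3 := (h1.add h2).pow 3
    simp only [abs_zero, add_zero] at h3
    rw [zero_pow (by norm_num)] at h3
    refine h3.congr' ?_
    filter_upwards [self_mem_nhdsWithin] with r hr
    rw [abs_mul, abs_of_nonneg (Real.rpow_nonneg (le_of_lt hr) _)]
    ring
  have hn : Filter.Tendsto (fun u : ℂ => ‖u‖) (nhdsWithin 0 {0}ᶜ) (nhdsWithin 0 (Set.Ioi 0)) :=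
    tendsto_norm_nhdsNE_zero
  have h4 : Filter.Tendsto (fun u : ℂ => u * Complex.log u ^ 3) (nhdsWithin 0 {0}ᶜ) (nhds 0) := by
    refine squeeze_zero_norm' ?_ (key.comp hn)
    filter_upwards [self_mem_nhdsWithin] with u hu
    have hu : 0 < ‖u‖ := norm_pos_iff.mpr hu
    simp only [Function.comp, norm_mul, norm_pow]
    rw [mul_pow, ← Real.rpow_natCast (‖u‖ ^ (1/3:ℝ)), ← Real.rpow_mul hu.le]
    norm_num
    gcongr
    calc ‖Complex.log u‖ ≤ |(Complex.log u).re| + |(Complex.log u).im| := Complex.norm_le_abs_re_add_abs_im _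
      _ ≤ _ := by
        rw [Complex.log_re, Complex.log_im]
        gcongr
        exact Complex.abs_arg_le_pi u
  rw [continuousAt_iff_punctured_nhds]
  have h5 : Filter.Tendsto (fun u : ℂ => u - 1) (nhdsWithin 0 {0}ᶜ) (nhds (0 - 1)) :=
    ((continuous_id.sub continuous_const).tendsto (0:ℂ)).mono_left nhdsWithin_le_nhds
  have := h4.div h5 (by norm_num)
  simp at this ⊢
  exact this

noncomputable def gFun (z : ℂ) : ℂ :=
  (fun u : ℂ => u * Complex.log u ^ 3 / (u - 1)) ((1 + z) / 2)

lemma gFun_mean : ContinuousOn gFun (Metric.closedBall 0 |1|) ∧ circleAverage gFun 0 1 = gFun 0 := by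
  have hc : ∀ z : ℂ, ‖z‖ ≤ 1 → z ≠ -1 → (1 + z) / 2 ∈ Complex.slitPlane := by
    intro z hz h1
    left
    have hr := Complex.abs_re_le_norm z
    have : -1 ≤ z.re := by have := abs_le.mp (hr.trans hz); linarith
    rcases this.lt_or_eq with h | h
    · have : ((1 + z) / 2).re = (1 + z.re) / 2 := by
        rw [show ((1 + z) / 2) = (1 + z) / ((2:ℝ):ℂ) by norm_num, Complex.div_ofReal_re]; simp
      rw [this]; linarith
    · exfalso
      apply h1
      have h2 : z.re ^ 2 + z.im ^ 2 ≤ 1 := by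
        have := Complex.sq_norm z
        rw [Complex.normSq_apply] at this
        nlinarith [norm_nonneg z]
      have : z.im = 0 := by nlinarith [sq_nonneg z.im]
      apply Complex.ext <;> simp [this, ← h]
  have hcont : ContinuousOn gFun (Metric.closedBall 0 |1|) := by
    intro z hz
    simp at hz
    apply ContinuousAt.continuousWithinAt
    unfold gFun
    refine ContinuousAt.comp (f := fun z : ℂ => (1 + z) / 2) (g := fun u : ℂ => u * Complex.log u ^ 3 / (u - 1)) ?_ (by fun_prop)
    by_cases h : z = -1
    · simpa [h] using cont_aux0
    · exact cont_aux1 (hc z hz h)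
  refine ⟨hcont, ?_⟩
  apply circleAverage_of_differentiable_on_off_countable Set.countable_empty hcont
  · intro z hz
    simp at hz
    have h1 : z ≠ -1 := by rintro rfl; simp at hz
    have h2 : z ≠ 1 := by rintro rfl; simp at hz
    have := hc z hz.le h1
    unfold gFun
    have h3 : (1 + z) / 2 - 1 ≠ 0 := by
      intro h; apply h2; linear_combination 2 * h
    have h4 : DifferentiableAt ℂ (fun z : ℂ => Complex.log ((1 + z) / 2)) z :=
      DifferentiableAt.clog (by fun_prop) this
    exact ((by fun_prop : DifferentiableAt ℂ (fun z : ℂ => (1+z)/2) z).mul (h4.pow 3)).div (by fun_prop) h3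

noncomputable def kFun (x : ℝ) : ℝ := (gFun (circleMap 0 1 (2 * x))).re

lemma kFun_cont : Continuous kFun := by
  unfold kFun
  apply Complex.continuous_re.comp
  refine gFun_mean.1.comp_continuous (by fun_prop) ?_
  intro x
  simp

lemma kFun_eq {x : ℝ} (h1 : -(π / 2) < x) (h2 : x < π / 2) :
    kFun x = (3 * x * Real.log (Real.cos x) ^ 2 - x ^ 3) * (Real.cos x / Real.sin x) := by
  have hc : 0 < Real.cos x := Real.cos_pos_of_mem_Ioo ⟨h1, h2⟩
  have hu : (1 + circleMap 0 1 (2 * x)) / 2 = (Real.cos x : ℂ) * Complex.exp (x * Complex.I) := by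
    simp only [circleMap, Complex.ofReal_cos, Complex.cos]
    have : Complex.exp ((2 * x : ℝ) * Complex.I) = Complex.exp (x * Complex.I) ^ 2 := by
      rw [← Complex.exp_nat_mul]; push_cast; ring_nf
    have h3 : Complex.exp (-x * Complex.I) * Complex.exp (x * Complex.I) = 1 := by
      rw [← Complex.exp_add]; simp
    rw [this]
    simp only [zero_add, Complex.ofReal_one, one_mul]
    linear_combination -h3 / 2
  have hl : Complex.log ((1 + circleMap 0 1 (2 * x)) / 2) = Real.log (Real.cos x) + x * Complex.I := by
    rw [hu, Complex.log_ofReal_mul hc (Complex.exp_ne_zero _), Complex.log_exp]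
    · simp; linarith [Real.pi_pos]
    · simp; linarith [Real.pi_pos]
  have hu1 : (1 + circleMap 0 1 (2 * x)) / 2 - 1 = (Real.sin x * Complex.I) * Complex.exp (x * Complex.I) := by
    rw [hu, Complex.exp_mul_I, Complex.ofReal_cos, Complex.ofReal_sin]
    linear_combination Complex.sin_sq_add_cos_sq (x : ℂ) - Complex.sin (x : ℂ) ^ 2 * Complex.I_sq
  have hg : gFun (circleMap 0 1 (2 * x)) =
      ((Real.cos x / Real.sin x : ℝ) : ℂ) * (-Complex.I * (Real.log (Real.cos x) + x * Complex.I) ^ 3) := by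
    simp only [gFun]
    rw [hl, hu1, hu, mul_right_comm, mul_div_mul_right _ _ (Complex.exp_ne_zero _)]
    by_cases hs : Real.sin x = 0
    · simp [hs]
    · have : (Real.sin x : ℂ) ≠ 0 := by exact_mod_cast hs
      rw [Complex.ofReal_div]
      field_simp
      linear_combination ((Real.cos x : ℂ) * (Real.log (Real.cos x) + x * Complex.I) ^ 3) * Complex.I_sq
  rw [kFun, hg, Complex.re_ofReal_mul, mul_comm]
  congr 1
  have : -Complex.I * ((Real.log (Real.cos x) : ℂ) + x * Complex.I) ^ 3 =
     ((3 * x * Real.log (Real.cos x) ^ 2 - x ^ 3 : ℝ) : ℂ) + ((3 * x^2 * Real.log (Real.cos x) - Real.log (Real.cos x)^3 : ℝ) : ℂ) * Complex.I := by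
    push_cast
    linear_combination (-3 * x * (Real.log (Real.cos x) : ℂ)^2 - 3*x^2*(Real.log (Real.cos x) : ℂ) * Complex.I - x^3 * (Complex.I^2 - 1)) * Complex.I_sq
  rw [this, Complex.add_re, Complex.re_ofReal_mul, Complex.ofReal_re, Complex.I_re, mul_zero, add_zero]

lemma kFun_int : ∫ x in (0:ℝ)..(π/2), kFun x = π / 2 * Real.log 2 ^ 3 := by
  have h := gFun_mean.2
  have h0 : gFun 0 = ((Real.log 2 ^ 3 : ℝ) : ℂ) := by
    have : Complex.log (1/2) = -((Real.log 2 : ℝ) : ℂ) := by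
      rw [show (1/2:ℂ) = ((1/2 : ℝ) : ℂ) by norm_num, ← Complex.ofReal_log (by norm_num)]
      simp [Real.log_inv]
    simp only [gFun, add_zero]
    rw [this]
    push_cast
    ring
  rw [h0, circleAverage_def] at h
  have hper : Function.Periodic (fun θ => gFun (circleMap 0 1 θ)) (2 * π) := by
    intro θ
    simp [periodic_circleMap 0 1 θ]
  have h1 := hper.intervalIntegral_add_eq 0 (-π)
  rw [zero_add, show -π + 2 * π = π by ring] at h1
  rw [h1] at h
  have hI : IntervalIntegrable (fun θ => gFun (circleMap 0 1 θ)) MeasureTheory.volume (-π) π := by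
    apply Continuous.intervalIntegrable
    refine gFun_mean.1.comp_continuous (by fun_prop) ?_
    intro x
    simp
  have h2 : ∫ θ in (-π)..π, (gFun (circleMap 0 1 θ)).re = 2 * π * Real.log 2 ^ 3 := by
    have h3 := Complex.reCLM.intervalIntegral_comp_comm hI
    simp only [Complex.reCLM_apply] at h3
    rw [h3]
    have : (∫ θ in (-π)..π, gFun (circleMap 0 1 θ)) = ((2 * π * Real.log 2 ^ 3 : ℝ) : ℂ) := by
      have hp : (2 * π) ≠ 0 := by positivity
      have := congrArg (fun z => (2 * π) • z) h
      simp only [smul_smul, mul_inv_cancel₀ hp, one_smul] at this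
      rw [this]; simp
    rw [this, Complex.ofReal_re]
  have h4 : ∫ x in (-(π/2))..(π/2), kFun x = π * Real.log 2 ^ 3 := by
    have := intervalIntegral.integral_comp_mul_left (a := -(π/2)) (b := π/2) (fun θ => (gFun (circleMap 0 1 θ)).re) (two_ne_zero (α := ℝ))
    unfold kFun
    rw [this, show 2 * -(π/2) = -π by ring, show 2 * (π/2) = π by ring, h2]
    simp; ring
  have hi : ∀ a b, IntervalIntegrable kFun MeasureTheory.volume a b := fun a b => kFun_cont.intervalIntegrable a b
  rw [← intervalIntegral.integral_add_adjacent_intervals (hi _ 0) (hi 0 _)] at h4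
  have h5 : ∫ x in (-(π/2))..0, kFun x = ∫ x in (0:ℝ)..(π/2), kFun x := by
    rw [← neg_zero, ← intervalIntegral.integral_comp_neg, neg_zero]
    apply intervalIntegral.integral_congr_ae
    have hne : ∀ᵐ x : ℝ, x ≠ π / 2 := MeasureTheory.Measure.ae_ne _ _
    filter_upwards [hne] with x hx hm
    rw [Set.uIoc_of_le (by positivity)] at hm
    have : x < π / 2 := lt_of_le_of_ne hm.2 hx
    have := hm.1
    rw [kFun_eq (by linarith) (by linarith), kFun_eq (by linarith) (by linarith), Real.cos_neg, Real.sin_neg]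
    rw [div_neg]; ring
  rw [h5] at h4
  linarith

lemma alt_log_two :
    Filter.Tendsto (fun k => ∑ i ∈ Finset.range k, (-1 : ℝ) ^ i / (i + 1)) Filter.atTop (nhds (Real.log 2)) := by
  obtain ⟨l, h⟩ :
      ∃ l, Filter.Tendsto (fun n ↦ ∑ i ∈ Finset.range n, (-1 : ℝ) ^ i / (i + 1)) Filter.atTop (nhds l) := by
    apply Antitone.tendsto_alternating_series_of_tendsto_zero
    · exact antitone_iff_forall_lt.mpr fun _ _ _ ↦ by gcongr
    · apply Filter.Tendsto.inv_tendsto_atTop; apply Filter.tendsto_atTop_add_const_right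
      exact tendsto_natCast_atTop_atTop
  have abel := Real.tendsto_tsum_powerSeries_nhdsWithin_lt h
  have m : nhdsWithin (1 : ℝ) (Set.Iio 1) ≤ nhds 1 := nhdsWithin_le_nhds
  have abel2 := abel.mul (Filter.tendsto_id.mono_left m)
  rw [mul_one] at abel2
  have h3 : Filter.Tendsto (fun x : ℝ => Real.log (1 + x)) (nhdsWithin (1 : ℝ) (Set.Iio 1)) (nhds l) := by
    refine abel2.congr' ?_
    filter_upwards [Ioo_mem_nhdsLT (show (0:ℝ) < 1 by norm_num)] with x hx
    have := hasSum_pow_div_log_of_abs_lt_one (x := -x) (by rw [abs_neg, abs_of_pos hx.1]; exact hx.2)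
    have := this.neg.tsum_eq
    rw [neg_neg, sub_neg_eq_add] at this
    rw [← this, ← tsum_mul_right]
    congr 1
    funext n
    simp only [id]
    rw [neg_pow x]; ring
  have h4 : Filter.Tendsto (fun x : ℝ => Real.log (1 + x)) (nhdsWithin (1 : ℝ) (Set.Iio 1)) (nhds (Real.log (1 + 1))) := by
    refine Filter.Tendsto.mono_left (ContinuousAt.tendsto ?_) m
    exact ContinuousAt.log (by fun_prop) (by norm_num)
  rw [tendsto_nhds_unique h3 h4] at h
  norm_num at h ⊢
  exact h

lemma alt_zeta :
    Filter.Tendsto (fun k => ∑ i ∈ Finset.range k, (-1 : ℝ) ^ i / (i + 1) ^ 3) Filter.atTop (nhds (3 / 4 * zetaVal 3)) := by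
  have hs0 : Summable (fun n : ℕ => 1 / (n : ℝ) ^ 3) := Real.summable_one_div_nat_pow.mpr (by norm_num)
  have hs : Summable (fun n : ℕ => 1 / ((n : ℝ) + 1) ^ 3) := by
    have := (summable_nat_add_iff 1).mpr hs0
    simpa using this
  have hz := hs.hasSum
  change HasSum _ (zetaVal 3) at hz
  -- odd-indexed terms
  have ho : HasSum (fun k : ℕ => 1 / (((2 * k + 1 : ℕ) : ℝ) + 1) ^ 3) (1 / 8 * zetaVal 3) := by
    refine (hz.mul_left (1/8)).congr_fun ?_ 
    intro k
    push_cast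
    rw [show (2 * (k:ℝ) + 1 + 1) = 2 * (k + 1) by ring, mul_pow]
    field_simp; norm_num
  have he : HasSum (fun k : ℕ => 1 / (((2 * k : ℕ) : ℝ) + 1) ^ 3) (7 / 8 * zetaVal 3) := by
    have hse : Summable (fun k : ℕ => 1 / (((2 * k : ℕ) : ℝ) + 1) ^ 3) :=
      hs.comp_injective (i := fun k : ℕ => 2 * k) (fun a b h => by simpa using h)
    have := (HasSum.even_add_odd (f := fun n : ℕ => 1 / ((n : ℝ) + 1) ^ 3) hse.hasSum ho).unique hz
    have h2 := hse.hasSum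
    rwa [show ∑' k : ℕ, 1 / (((2 * k : ℕ) : ℝ) + 1) ^ 3 = 7 / 8 * zetaVal 3 by linarith] at h2
  have : HasSum (fun i : ℕ => (-1 : ℝ) ^ i / (i + 1) ^ 3) (7 / 8 * zetaVal 3 + -(1 / 8 * zetaVal 3)) := by
    apply HasSum.even_add_odd
    · simpa using he
    · have := ho.neg
      simpa [pow_succ, neg_div] using this
  rw [show 7 / 8 * zetaVal 3 + -(1 / 8 * zetaVal 3) = 3 / 4 * zetaVal 3 by ring] at this
  exact this.tendsto_sum_nat

lemma dirichlet_kernel (x : ℝ) (hx : Real.sin x ≠ 0) (n : ℕ) :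
    Real.cos x / Real.sin x = ∑ k ∈ Finset.range n, 2 * Real.sin (2 * (k + 1) * x) +
      Real.cos ((2 * n + 1) * x) / Real.sin x := by
  induction n with
  | zero => simp
  | succ n ih =>
    rw [ih, Finset.sum_range_succ]
    have h1 : Real.cos ((2 * n + 1) * x) = Real.cos (2 * (n + 1) * x) * Real.cos x + Real.sin (2 * (n + 1) * x) * Real.sin x := by
      rw [← Real.cos_sub]; ring_nf
    have h2 : Real.cos ((2 * (n + 1 : ℕ) + 1) * x) = Real.cos (2 * (n + 1) * x) * Real.cos x - Real.sin (2 * (n + 1) * x) * Real.sin x := by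
      rw [← Real.cos_add]; push_cast; ring_nf
    rw [h1, h2, add_assoc]
    congr 1
    field_simp
    ring

lemma int_x3_sin (k : ℕ) : ∫ x in (0:ℝ)..(π/2), x ^ 3 * (2 * Real.sin (2 * (k + 1) * x)) =
    π ^ 3 / 8 * ((-1) ^ k / (k + 1)) - 3 * π / 4 * ((-1) ^ k / (k + 1) ^ 3) := by
  have hk : (0:ℝ) < k + 1 := by positivity
  set m : ℝ := k + 1 with hm
  have hd : ∀ x ∈ Set.uIcc 0 (π/2), HasDerivAt (fun x => -x^3 * Real.cos (2 * m * x) / m + 3 * x^2 * Real.sin (2*m*x) / (2*m^2)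
      + 3 * x * Real.cos (2*m*x) / (2 * m^3) - 3 * Real.sin (2*m*x) / (4*m^4)) (x ^ 3 * (2 * Real.sin (2 * m * x))) x := by
    intro x _
    have hl : HasDerivAt (fun x : ℝ => 2 * m * x) (2 * m) x := by
      simpa using (hasDerivAt_id x).const_mul (2 * m)
    have hc := hl.cos
    have hs := hl.sin
    have h3 := (hasDerivAt_pow 3 x).neg
    have h2 := (hasDerivAt_pow 2 x).const_mul 3
    have h1 := (hasDerivAt_id x).const_mul 3
    have := ((((h3.mul hc).div_const m).add ((h2.mul hs).div_const (2*m^2))).add ((h1.mul hc).div_const (2*m^3))).sub ((hs.const_mul 3).div_const (4*m^4))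
    convert! this using 1
    simp
    field_simp
    ring
  rw [intervalIntegral.integral_eq_sub_of_hasDerivAt hd (Continuous.intervalIntegrable (by fun_prop) _ _)]
  have e : 2 * m * (π / 2) = ((k + 1 : ℕ) : ℝ) * π := by rw [hm]; push_cast; ring
  rw [e, Real.cos_nat_mul_pi, Real.sin_nat_mul_pi]
  simp
  field_simp
  ring

lemma x3_sin_cont : ContinuousOn (fun x : ℝ => x ^ 3 / Real.sin x) (Set.Icc 0 (π/2)) := by
  have e : Set.EqOn (fun x : ℝ => x ^ 3 / Real.sin x) (fun x => x ^ 2 / Real.sinc x) (Set.Icc 0 (π/2)) := by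
    intro x hx
    by_cases h : x = 0
    · simp [h]
    · simp only [Real.sinc_of_ne_zero h]
      field_simp
  refine ContinuousOn.congr ?_ e
  apply ContinuousOn.div (by fun_prop) Real.continuous_sinc.continuousOn
  intro x hx
  by_cases h : x = 0
  · simp [h]
  · rw [Real.sinc_of_ne_zero h]
    have : 0 < x := lt_of_le_of_ne hx.1 (Ne.symm h)
    have := Real.sin_pos_of_pos_of_lt_pi this (by linarith [hx.2, Real.pi_pos])
    positivity

lemma RL : Filter.Tendsto (fun n : ℕ => ∫ x in (0:ℝ)..(π/2), x ^ 3 / Real.sin x * Real.cos ((2 * n + 1) * x))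
    Filter.atTop (nhds 0) := by
  set f : ℝ → ℂ := (Set.Ioc 0 (π/2)).indicator (fun x => ((x ^ 3 / Real.sin x : ℝ) : ℂ)) with hf
  have h := Real.tendsto_integral_exp_smul_cocompact f
  have hw : Filter.Tendsto (fun n : ℕ => (2 * (n:ℝ) + 1) / (2 * π)) Filter.atTop (Filter.cocompact ℝ) := by
    refine Filter.Tendsto.mono_right ?_ atTop_le_cocompact
    apply Filter.Tendsto.atTop_div_const (by positivity)
    apply Filter.tendsto_atTop_add_const_right
    exact tendsto_natCast_atTop_atTop.const_mul_atTop zero_lt_two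
  have h2 := (Complex.continuous_re.tendsto _).comp (h.comp hw)
  rw [Complex.zero_re] at h2
  refine h2.congr ?_
  intro n
  simp only [Function.comp]
  have e : ∀ v : ℝ, (Real.fourierChar (-(v * ((2 * (n:ℝ) + 1) / (2 * π)))) : ℂ) * f v =
      (Set.Ioc 0 (π/2)).indicator (fun v => Complex.exp (-((2 * n + 1) * v : ℝ) * Complex.I) * ((v ^ 3 / Real.sin v : ℝ) : ℂ)) v := by
    intro v
    rw [hf]
    by_cases hv : v ∈ Set.Ioc 0 (π/2)
    · simp only [Set.indicator_of_mem hv]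
      rw [Real.fourierChar_apply]
      congr 3
      push_cast
      have : (π : ℂ) ≠ 0 := by exact_mod_cast Real.pi_ne_zero
      field_simp
    · simp [Set.indicator_of_notMem hv]
  simp only [Circle.smul_def, smul_eq_mul, e]
  rw [MeasureTheory.integral_indicator measurableSet_Ioc, ← intervalIntegral.integral_of_le (by positivity)]
  have hI : IntervalIntegrable (fun v : ℝ => Complex.exp (-((2 * n + 1) * v : ℝ) * Complex.I) * ((v ^ 3 / Real.sin v : ℝ) : ℂ)) MeasureTheory.volume 0 (π/2) := by
    apply ContinuousOn.intervalIntegrable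
    rw [Set.uIcc_of_le (by positivity)]
    apply ContinuousOn.mul (by fun_prop)
    exact Complex.continuous_ofReal.comp_continuousOn x3_sin_cont
  have h3 := Complex.reCLM.intervalIntegral_comp_comm hI
  simp only [Complex.reCLM_apply] at h3
  rw [← h3]
  congr 1
  funext v
  rw [Complex.re_mul_ofReal, ← Complex.ofReal_neg, Complex.exp_ofReal_mul_I_re, Real.cos_neg, mul_comm]

lemma J_eq : ∫ x in (0:ℝ)..(π/2), x ^ 3 * (Real.cos x / Real.sin x) =
    π ^ 3 / 8 * Real.log 2 - 3 * π / 4 * (3 / 4 * zetaVal 3) := by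
  have hn : ∀ n : ℕ, ∫ x in (0:ℝ)..(π/2), x ^ 3 * (Real.cos x / Real.sin x) =
      (π ^ 3 / 8 * (∑ k ∈ Finset.range n, (-1:ℝ) ^ k / (k + 1)) - 3 * π / 4 * ∑ k ∈ Finset.range n, (-1:ℝ) ^ k / (k + 1)^3)
      + ∫ x in (0:ℝ)..(π/2), x ^ 3 / Real.sin x * Real.cos ((2 * n + 1) * x) := by
    intro n
    rw [Finset.mul_sum, Finset.mul_sum, ← Finset.sum_sub_distrib]
    simp_rw [← int_x3_sin]
    rw [← intervalIntegral.integral_finsetSum, ← intervalIntegral.integral_add]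
    · apply intervalIntegral.integral_congr
      intro x hx
      rw [Set.uIcc_of_le (by positivity)] at hx
      simp only
      by_cases h : x = 0
      · simp [h]
      have : 0 < x := lt_of_le_of_ne hx.1 (Ne.symm h)
      have := Real.sin_pos_of_pos_of_lt_pi this (by linarith [hx.2, Real.pi_pos])
      rw [dirichlet_kernel x this.ne' n, mul_add, Finset.mul_sum]
      ring
    · apply Continuous.intervalIntegrable
      fun_prop
    · apply ContinuousOn.intervalIntegrable
      rw [Set.uIcc_of_le (by positivity)]
      exact x3_sin_cont.mul (by fun_prop)
    · intro i _
      apply Continuous.intervalIntegrable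
      fun_prop
  have ht := ((alt_log_two.const_mul (π^3/8)).sub (alt_zeta.const_mul (3*π/4))).add RL
  rw [add_zero] at ht
  refine tendsto_nhds_unique (Filter.Tendsto.congr (fun n => hn n) tendsto_const_nhds) ht

theorem stmt_11 :
    ∫ x in (0 : ℝ)..(π / 2), x * (Real.cos x / Real.sin x) * (Real.log (Real.cos x)) ^ 2
    = -(3 * π / 16) * zetaVal 3 + π ^ 3 / 24 * Real.log 2 + π / 6 * Real.log 2 ^ 3 := by
  have hJ : IntervalIntegrable (fun x : ℝ => x ^ 3 * (Real.cos x / Real.sin x)) MeasureTheory.volume 0 (π/2) := by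
    apply ContinuousOn.intervalIntegrable
    rw [Set.uIcc_of_le (by positivity)]
    refine (x3_sin_cont.mul Real.continuous_cos.continuousOn).congr ?_
    intro x _
    simp only [Pi.mul_apply]
    ring
  have hk : IntervalIntegrable kFun MeasureTheory.volume 0 (π/2) := kFun_cont.intervalIntegrable _ _
  have e : ∫ x in (0 : ℝ)..(π / 2), x * (Real.cos x / Real.sin x) * (Real.log (Real.cos x)) ^ 2 =
      ∫ x in (0 : ℝ)..(π / 2), 1 / 3 * (kFun x + x ^ 3 * (Real.cos x / Real.sin x)) := by
    apply intervalIntegral.integral_congr_ae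
    have hne : ∀ᵐ x : ℝ, x ≠ π / 2 := MeasureTheory.Measure.ae_ne _ _
    filter_upwards [hne] with x hx hm
    rw [Set.uIoc_of_le (by positivity)] at hm
    have : x < π / 2 := lt_of_le_of_ne hm.2 hx
    have := hm.1
    rw [kFun_eq (by linarith [Real.pi_pos]) (by linarith)]
    ring
  rw [e, intervalIntegral.integral_const_mul, intervalIntegral.integral_add hk hJ, kFun_int, J_eq]
  ring
end
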